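/- arXiv:math/0101033 — 5 statements merged into one kernel-verified Lean document; each statement's English description precedes it below -/
import Mathlib

section
/- Let d ∈ {1, 2, 4, 8} and n ≥ 1. Let Y ⊆ ℝⁿ be a closed set, let U ⊆ ℝⁿ be an open set containing Y, and let f : U → ℝᵈ be a C^∞ map such that Y = {x ∈ U : f(x) = 0} and the derivative Df(x) : ℝⁿ → ℝᵈ is surjective at every point x ∈ Y. Then there exists a C^∞ map F : ℝⁿ → ℝᵈ such that Y = {x ∈ ℝⁿ : F(x) = 0} and DF(x) : ℝⁿ → ℝᵈ is surjective at every point x ∈ Y (i.e., Y is a differentiable complete intersection in ℝⁿ). -/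
namespace DCI

open Set Filter Topology

def clamp {n : ℕ} (R : ℝ) (x : Fin n → ℝ) : Fin n → ℝ := fun i => max (-R) (min R (x i))

lemma clamp_cont {n : ℕ} (R : ℝ) : Continuous (clamp R : (Fin n → ℝ) → (Fin n → ℝ)) := by
  unfold clamp; fun_prop

lemma clamp_eq {n : ℕ} {R : ℝ} {x : Fin n → ℝ} (h : ‖x‖ ≤ R) : clamp R x = x := by
  funext i
  have h1 := (norm_le_pi_norm x i).trans h
  rw [Real.norm_eq_abs, abs_le] at h1
  simp [clamp, h1.1, h1.2]

lemma clamp_zero {n : ℕ} (x : Fin n → ℝ) : clamp 0 x = 0 := by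
  funext i
  simp [clamp]

lemma clamp_norm {n : ℕ} {R : ℝ} (hR : 0 ≤ R) (x : Fin n → ℝ) : ‖clamp R x‖ ≤ R := by
  rw [pi_norm_le_iff_of_nonneg hR]
  intro i
  rw [Real.norm_eq_abs, abs_le]
  exact ⟨le_max_left _ _, max_le (by linarith) (min_le_left _ _)⟩

lemma clamp_dist {n : ℕ} {R R' : ℝ} (h : R ≤ R') (x : Fin n → ℝ) :
    dist (clamp R' x) (clamp R x) ≤ R' - R := by
  rw [dist_pi_le_iff (by linarith)]
  intro i
  rw [Real.dist_eq, abs_le]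
  simp only [clamp, max_def, min_def]
  constructor <;> split_ifs <;> linarith

set_option linter.unusedSectionVars false

variable {n : ℕ} {B : Type*} [NormedRing B] [CompleteSpace B]

lemma step_unit {p : (Fin n → ℝ) → B} (hp : Continuous p) (hid : ∀ x, p x * p x = p x) (M : ℝ) :
    ∃ δ > 0, ∀ y z : Fin n → ℝ, ‖y‖ ≤ M → ‖z‖ ≤ M → dist y z ≤ δ →
      IsUnit (p y * p z + (1 - p y) * (1 - p z)) := by
  have hc : Continuous (fun w : (Fin n → ℝ) × (Fin n → ℝ) =>
    p w.1 * p w.2 + (1 - p w.1) * (1 - p w.2)) := by fun_prop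
  have hK : IsCompact (Metric.closedBall (0 : Fin n → ℝ) M ×ˢ Metric.closedBall (0 : Fin n → ℝ) M) :=
    (isCompact_closedBall _ _).prod (isCompact_closedBall _ _)
  have hu := hK.uniformContinuousOn_of_continuous hc.continuousOn
  rw [Metric.uniformContinuousOn_iff] at hu
  obtain ⟨δ, hδ, h⟩ := hu 1 one_pos
  refine ⟨δ / 2, by linarith, fun y z hy hz hd => ?_⟩
  have := h (y, z) (by simp [hy, hz]) (z, z) (by simp [hz])
    (by rw [Prod.dist_eq]; simp only [dist_self]; exact max_lt (by linarith) hδ)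
  have e : p z * p z + (1 - p z) * (1 - p z) = 1 := by
    have := hid z
    noncomm_ring
    simp [this]
  simp only [e] at this
  rw [dist_comm, dist_eq_norm] at this
  have := (Units.oneSub _ this).isUnit
  simpa using this

def Rel (p : (Fin n → ℝ) → B) (R R' : ℝ) : Prop :=
  ∃ Q : (Fin n → ℝ) → B, Continuous Q ∧ (∀ x, IsUnit (Q x)) ∧
    (∀ x, p (clamp R' x) * Q x = Q x * p (clamp R x)) ∧ ∀ x, ‖x‖ ≤ R → Q x = 1

lemma Rel.trans {p : (Fin n → ℝ) → B} {R R' R'' : ℝ} (h : R ≤ R')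
    (h1 : Rel p R R') (h2 : Rel p R' R'') : Rel p R R'' := by
  obtain ⟨Q, a, b, c, e⟩ := h1
  obtain ⟨Q', a', b', c', e'⟩ := h2
  refine ⟨fun x => Q' x * Q x, a'.mul a, fun x => (b' x).mul (b x), fun x => ?_, fun x hx => ?_⟩
  · rw [← mul_assoc, c', mul_assoc, c, mul_assoc]
  · simp [e x hx, e' x (hx.trans h)]

lemma rel_of_le {p : (Fin n → ℝ) → B} (hp : Continuous p) (hid : ∀ x, p x * p x = p x)
    {R R' : ℝ} (h0 : 0 ≤ R) (hR : R ≤ R') : Rel p R R' := by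
  obtain ⟨δ, hδ, H⟩ := step_unit hp hid R'
  have base : ∀ R₁ R₂, 0 ≤ R₁ → R₁ ≤ R₂ → R₂ ≤ R' → R₂ - R₁ ≤ δ → Rel p R₁ R₂ := by
    intro R₁ R₂ h1 h2 h3 h4
    refine ⟨fun x => p (clamp R₂ x) * p (clamp R₁ x) + (1 - p (clamp R₂ x)) * (1 - p (clamp R₁ x)),
      ?_, fun x => H _ _ ?_ ?_ ?_, fun x => ?_, fun x hx => ?_⟩
    · have := clamp_cont (n := n) R₁
      have := clamp_cont (n := n) R₂
      fun_prop
    · exact (clamp_norm (h1.trans h2) x).trans h3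
    · exact (clamp_norm h1 x).trans (h2.trans h3)
    · exact (clamp_dist h2 x).trans h4
    · beta_reduce
      have e1 := hid (clamp R₁ x)
      have e2 := hid (clamp R₂ x)
      generalize p (clamp R₁ x) = a at *
      generalize p (clamp R₂ x) = b at *
      have l : b * (b * a + (1 - b) * (1 - a)) = (b * b) * a + (b - b * b) * (1 - a) := by
        noncomm_ring
      have r : (b * a + (1 - b) * (1 - a)) * a = b * (a * a) + (1 - b) * (a - a * a) := by
        noncomm_ring
      rw [l, r, e1, e2]; simp
    · beta_reduce
      rw [clamp_eq hx, clamp_eq (hx.trans h2)]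
      have := hid x
      noncomm_ring
      simp [this]
  have ind : ∀ N : ℕ, ∀ R₂, R ≤ R₂ → R₂ ≤ R' → R₂ - R ≤ N * δ → Rel p R R₂ := by
    intro N
    induction N with
    | zero =>
      intro R₂ h1 h2 h3
      simp at h3
      exact base _ _ h0 h1 h2 (by linarith)
    | succ k ih =>
      intro R₂ h1 h2 h3
      push_cast at h3
      have hm : R ≤ max R (R₂ - δ) := le_max_left _ _
      refine (ih (max R (R₂ - δ)) hm (max_le hR (by linarith)) ?_).trans hm
        (base _ _ (h0.trans hm) (max_le h1 (by linarith)) h2 ?_)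
      · have : 0 ≤ (k:ℝ) * δ := by positivity
        rcases max_cases R (R₂ - δ) with h | h <;> linarith
      · linarith [le_max_right R (R₂ - δ)]
  obtain ⟨N, hN⟩ := exists_nat_ge ((R' - R) / δ)
  exact ind N R' hR le_rfl ((div_le_iff₀ hδ).1 hN)

lemma exists_triv {p : (Fin n → ℝ) → B} (hp : Continuous p) (hid : ∀ x, p x * p x = p x) :
    ∃ Ψ : (Fin n → ℝ) → B, Continuous Ψ ∧ (∀ x, IsUnit (Ψ x)) ∧ ∀ x, p x * Ψ x = Ψ x * p 0 := by
  have H : ∀ m : ℕ, Rel p m (m + 1 : ℕ) := fun m =>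
    rel_of_le hp hid (by positivity) (by push_cast; linarith)
  choose Q hc hu hq h1 using H
  let P : ℕ → (Fin n → ℝ) → B := fun m => Nat.rec (fun _ => 1) (fun k f x => Q k x * f x) m
  have P0 : ∀ x, P 0 x = 1 := fun _ => rfl
  have PS : ∀ m x, P (m + 1) x = Q m x * P m x := fun _ _ => rfl
  have Pc : ∀ m, Continuous (P m) := by
    intro m
    induction m with
    | zero => exact continuous_const
    | succ k ih => exact (hc k).mul ih
  have Pu : ∀ m x, IsUnit (P m x) := by
    intro m x
    induction m with
    | zero => exact isUnit_one
    | succ k ih => exact (hu k x).mul ih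
  have Pp : ∀ (m : ℕ) x, p (clamp m x) * P m x = P m x * p 0 := by
    intro m x
    induction m with
    | zero => simp [P0, clamp_zero]
    | succ k ih => rw [PS, ← mul_assoc, hq, mul_assoc, ih, mul_assoc]
  have Pe : ∀ (m : ℕ) x, ‖x‖ ≤ m → ∀ k, P (m + k) x = P m x := by
    intro m x hx k
    induction k with
    | zero => rfl
    | succ k ih => rw [← add_assoc, PS, ih, h1, one_mul]; push_cast; linarith [k.cast_nonneg (α := ℝ)]
  have Pe' : ∀ (m : ℕ) x, ‖x‖ ≤ m → P ⌈‖x‖⌉₊ x = P m x := by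
    intro m x hx
    have := Nat.ceil_le.2 hx
    obtain ⟨k, rfl⟩ := Nat.exists_eq_add_of_le this
    exact (Pe _ x (Nat.le_ceil _) k).symm
  refine ⟨fun x => P ⌈‖x‖⌉₊ x, ?_, fun x => Pu _ x, fun x => ?_⟩
  · rw [continuous_iff_continuousAt]
    intro x
    obtain ⟨m, hm⟩ := exists_nat_gt ‖x‖
    have : ∀ᶠ y in 𝓝 x, ‖y‖ < m := continuous_norm.continuousAt.eventually_lt continuousAt_const hm
    refine (Pc m).continuousAt.congr ?_
    filter_upwards [this] with y hy
    exact (Pe' m y hy.le).symm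
  · have := Pp ⌈‖x‖⌉₊ x
    rwa [clamp_eq (Nat.le_ceil _)] at this




def HasMul (d : ℕ) : Prop :=
  ∃ L L' : EuclideanSpace ℝ (Fin d) →ₗ[ℝ]
      (EuclideanSpace ℝ (Fin d) →L[ℝ] EuclideanSpace ℝ (Fin d)),
    ∃ e : EuclideanSpace ℝ (Fin d), e ≠ 0 ∧ (∀ a v, L a (L' a v) = ‖a‖ ^ 2 • v) ∧
      (∀ a v, L' a (L a v) = ‖a‖ ^ 2 • v) ∧ ∀ a, L a e = a

lemma hasMul_of_matrix {d : ℕ} (i₀ : Fin d) (M : (Fin d → ℝ) → Matrix (Fin d) (Fin d) ℝ)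
    (hadd : ∀ a b, M (a + b) = M a + M b) (hsmul : ∀ (c : ℝ) a, M (c • a) = c • M a)
    (hM : ∀ a, M a * (M a).transpose = (∑ i, a i ^ 2) • (1 : Matrix (Fin d) (Fin d) ℝ))
    (h1 : ∀ a i, M a i i₀ = a i) : HasMul d := by
  have hM' : ∀ a, (M a).transpose * M a = (∑ i, a i ^ 2) • (1 : Matrix (Fin d) (Fin d) ℝ) := by
    intro a
    by_cases h : (∑ i, a i ^ 2) = 0
    · have : a = 0 := by
        funext i
        have := (Finset.sum_eq_zero_iff_of_nonneg (fun i _ => sq_nonneg (a i))).1 h i (Finset.mem_univ _)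
        simpa using this
      have h2 : M a = 0 := by
        have h3 := hsmul 0 a
        rw [zero_smul, zero_smul] at h3
        rw [this, h3]
      rw [h, h2]; simp
    · have : M a * ((∑ i, a i ^ 2)⁻¹ • (M a).transpose) = 1 := by
        rw [Matrix.mul_smul, hM, smul_smul, inv_mul_cancel₀ h, one_smul]
      rw [mul_eq_one_comm, Matrix.smul_mul] at this
      rw [← this, smul_smul, mul_inv_cancel₀ h, one_smul]
  refine ⟨
    { toFun := fun a => Matrix.toEuclideanCLM (𝕜 := ℝ) (M (WithLp.ofLp a))
      map_add' := fun a b => by simp [hadd]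
      map_smul' := fun c a => by simp [hsmul] },
    { toFun := fun a => Matrix.toEuclideanCLM (𝕜 := ℝ) (M (WithLp.ofLp a)).transpose
      map_add' := fun a b => by simp [hadd]
      map_smul' := fun c a => by simp [hsmul] },
    EuclideanSpace.single i₀ 1, by simp, fun a v => ?_, fun a v => ?_, fun a => ?_⟩
  · ext i
    simp [Matrix.mulVec_mulVec, hM, EuclideanSpace.norm_sq_eq, Matrix.smul_mulVec]
  · ext i
    simp [Matrix.mulVec_mulVec, hM', EuclideanSpace.norm_sq_eq, Matrix.smul_mulVec]
  · ext i
    simp [h1]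

set_option maxHeartbeats 4000000 in
lemma hasMul_one : HasMul 1 := by
  refine hasMul_of_matrix 0 (fun a => !![a 0]) ?_ ?_ ?_ ?_
  · intro a b
    ext i j
    fin_cases i <;> fin_cases j <;> simp <;> ring
  · intro c a
    ext i j
    fin_cases i <;> fin_cases j <;> simp
  · intro a
    ext i j
    fin_cases i <;> fin_cases j <;>
      simp [Matrix.mul_apply, Fin.sum_univ_succ] <;> ring
  · intro a i
    fin_cases i <;> simp

set_option maxHeartbeats 4000000 in
lemma hasMul_two : HasMul 2 := by
  refine hasMul_of_matrix 0 (fun a => !![a 0, -a 1;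
    a 1, a 0]) ?_ ?_ ?_ ?_
  · intro a b
    ext i j
    fin_cases i <;> fin_cases j <;> simp <;> ring
  · intro c a
    ext i j
    fin_cases i <;> fin_cases j <;> simp
  · intro a
    ext i j
    fin_cases i <;> fin_cases j <;>
      simp [Matrix.mul_apply, Fin.sum_univ_succ] <;> ring
  · intro a i
    fin_cases i <;> simp

set_option maxHeartbeats 4000000 in
lemma hasMul_four : HasMul 4 := by
  refine hasMul_of_matrix 0 (fun a => !![a 0, -a 1, -a 2, -a 3;
    a 1, a 0, -a 3, a 2;
    a 2, a 3, a 0, -a 1;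
    a 3, -a 2, a 1, a 0]) ?_ ?_ ?_ ?_
  · intro a b
    ext i j
    fin_cases i <;> fin_cases j <;> simp <;> ring
  · intro c a
    ext i j
    fin_cases i <;> fin_cases j <;> simp
  · intro a
    ext i j
    fin_cases i <;> fin_cases j <;>
      simp [Matrix.mul_apply, Fin.sum_univ_succ] <;> ring
  · intro a i
    fin_cases i <;> simp

set_option maxHeartbeats 4000000 in
lemma hasMul_eight : HasMul 8 := by
  refine hasMul_of_matrix 0 (fun a => !![a 0, -a 1, -a 2, -a 3, -a 4, -a 5, -a 6, -a 7;
    a 1, a 0, -a 3, a 2, -a 5, a 4, a 7, -a 6;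
    a 2, a 3, a 0, -a 1, -a 6, -a 7, a 4, a 5;
    a 3, -a 2, a 1, a 0, -a 7, a 6, -a 5, a 4;
    a 4, a 5, a 6, a 7, a 0, -a 1, -a 2, -a 3;
    a 5, -a 4, a 7, -a 6, a 1, a 0, a 3, -a 2;
    a 6, -a 7, -a 4, a 5, a 2, -a 3, a 0, a 1;
    a 7, a 6, -a 5, -a 4, a 3, a 2, -a 1, a 0]) ?_ ?_ ?_ ?_
  · intro a b
    ext i j
    fin_cases i <;> fin_cases j <;> simp <;> ring
  · intro c a
    ext i j
    fin_cases i <;> fin_cases j <;> simp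
  · intro a
    ext i j
    fin_cases i <;> fin_cases j <;>
      simp [Matrix.mul_apply, Fin.sum_univ_succ] <;> ring
  · intro a i
    fin_cases i <;> simp


lemma hasMul_of_mem {d : ℕ} (hd : d ∈ ({1, 2, 4, 8} : Set ℕ)) : HasMul d := by
  rcases hd with rfl | rfl | rfl | rfl
  exacts [hasMul_one, hasMul_two, hasMul_four, hasMul_eight]



section proj
variable {d : ℕ}

local notation "𝔼" => EuclideanSpace ℝ (Fin d)

/-- The idempotent `diag(1,0) + t diag(-1,1) + k offdiag(l,l')`. -/
noncomputable def proj (t k : ℝ) (l l' : 𝔼 →L[ℝ] 𝔼) : (𝔼 × 𝔼) →L[ℝ] (𝔼 × 𝔼) :=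
  (ContinuousLinearMap.inl ℝ 𝔼 𝔼).comp (ContinuousLinearMap.fst ℝ 𝔼 𝔼)
  + t • ((ContinuousLinearMap.inr ℝ 𝔼 𝔼).comp (ContinuousLinearMap.snd ℝ 𝔼 𝔼)
        - (ContinuousLinearMap.inl ℝ 𝔼 𝔼).comp (ContinuousLinearMap.fst ℝ 𝔼 𝔼))
  + k • (((ContinuousLinearMap.inl ℝ 𝔼 𝔼).comp l).comp (ContinuousLinearMap.snd ℝ 𝔼 𝔼)
        + ((ContinuousLinearMap.inr ℝ 𝔼 𝔼).comp l').comp (ContinuousLinearMap.fst ℝ 𝔼 𝔼))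

lemma proj_apply (t k : ℝ) (l l' : 𝔼 →L[ℝ] 𝔼) (v w : 𝔼) :
    proj t k l l' (v, w) = (v - t • v + k • l w, t • w + k • l' v) := by
  ext1 <;> simp [proj, sub_eq_add_neg]

lemma proj_idem {t k s : ℝ} {l l' : 𝔼 →L[ℝ] 𝔼} (h1 : ∀ v, l (l' v) = s • v)
    (h2 : ∀ v, l' (l v) = s • v) (h : t ^ 2 + k ^ 2 * s = t) :
    proj t k l l' * proj t k l l' = proj t k l l' := by
  refine ContinuousLinearMap.ext fun ⟨v, w⟩ => ?_
  rw [mul_apply_eq_comp, proj_apply, proj_apply]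
  ext1
  · simp only [map_add, map_sub, map_smul, h1]
    linear_combination (norm := module) h • v
  · simp only [map_add, map_smul, map_sub, h2]
    linear_combination (norm := module) h • w

lemma proj_continuousAt {X : Type*} [TopologicalSpace X] {t k : X → ℝ} {l l' : X → 𝔼 →L[ℝ] 𝔼}
    {x : X} (ht : ContinuousAt t x) (hk : ContinuousAt k x) (hl : ContinuousAt l x)
    (hl' : ContinuousAt l' x) : ContinuousAt (fun x => proj (t x) (k x) (l x) (l' x)) x := by
  unfold proj
  fun_prop

end proj

theorem main {d n : ℕ} (hmul : HasMul d)
    (Y U : Set (EuclideanSpace ℝ (Fin n)))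
    (hYclosed : IsClosed Y) (hUopen : IsOpen U) (hYU : Y ⊆ U)
    (f : EuclideanSpace ℝ (Fin n) → EuclideanSpace ℝ (Fin d))
    (hf : ContDiffOn ℝ (⊤ : ℕ∞) f U)
    (hYzero : Y = {x ∈ U | f x = 0})
    (hfsurj : ∀ x ∈ Y, Function.Surjective (fderiv ℝ f x)) :
    ∃ F : EuclideanSpace ℝ (Fin n) → EuclideanSpace ℝ (Fin d),
      ContDiff ℝ (⊤ : ℕ∞) F ∧
      Y = {x | F x = 0} ∧
      ∀ x ∈ Y, Function.Surjective (fderiv ℝ F x) := by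
  obtain ⟨L, L', e, he, hL, hL', hLe⟩ := hmul
  rcases Y.eq_empty_or_nonempty with hY | ⟨y₀, hy₀⟩
  · refine ⟨fun _ => e, contDiff_const, ?_, ?_⟩
    · simp [hY, he]
    · simp [hY]
  obtain ⟨χ', h0, h1, -⟩ := exists_contMDiffMap_zero_one_nhds_of_isClosed
    (n := (⊤ : ℕ∞)) (modelWithCornersSelf ℝ (EuclideanSpace ℝ (Fin n)))
    hUopen.isClosed_compl hYclosed (disjoint_compl_left_iff_subset.2 hYU)
  obtain ⟨χ, hχ⟩ : ∃ χ : EuclideanSpace ℝ (Fin n) → ℝ, χ = χ' := ⟨_, rfl⟩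
  have hχs : ContDiff ℝ (⊤ : ℕ∞) χ := hχ ▸ χ'.contMDiff.contDiff
  rw [← hχ] at h0 h1
  have h0 : ∀ x, x ∉ U → ∀ᶠ y in 𝓝 x, χ y = 0 := fun x hx =>
    (eventually_nhdsSet_iff_forall.1 h0) x hx
  have h1 : ∀ x ∈ Y, ∀ᶠ y in 𝓝 x, χ y = 1 := fun x hx =>
    (eventually_nhdsSet_iff_forall.1 h1) x hx
  clear hχ χ'
  have hYf : ∀ x ∈ Y, f x = 0 := fun x hx => by rw [hYzero] at hx; exact hx.2
  -- the global objects
  let a : EuclideanSpace ℝ (Fin n) → EuclideanSpace ℝ (Fin d) := fun x => χ x • f x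
  let b : EuclideanSpace ℝ (Fin n) → ℝ := fun x => 1 - χ x
  let c : EuclideanSpace ℝ (Fin n) → ℝ := fun x => ‖a x‖ ^ 2 + b x ^ 2
  have has : ContDiff ℝ (⊤ : ℕ∞) a := by
    rw [contDiff_iff_contDiffAt]
    intro x
    by_cases hx : x ∈ U
    · exact hχs.contDiffAt.smul (hf.contDiffAt (hUopen.mem_nhds hx))
    · refine (contDiffAt_const (c := 0)).congr_of_eventuallyEq ?_
      filter_upwards [h0 x hx] with y hy
      simp [a, hy]
  have hbs : ContDiff ℝ (⊤ : ℕ∞) b := contDiff_const.sub hχs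
  have hb : ∀ x ∈ Y, ∀ᶠ y in 𝓝 x, b y = 0 := fun x hx => by
    filter_upwards [h1 x hx] with y hy
    simp [b, hy]
  have haf : ∀ x ∈ Y, ∀ᶠ y in 𝓝 x, a y = f y := fun x hx => by
    filter_upwards [h1 x hx] with y hy
    simp [a, hy]
  have hab : ∀ x, x ∉ Y → a x = 0 → b x = 0 → False := by
    intro x hx ha hb
    have h2 : χ x = 1 := by simp only [b] at hb; linarith
    have h3 : f x = 0 := by simpa [a, h2] using ha
    by_cases hxU : x ∈ U
    · exact hx (by rw [hYzero]; exact ⟨hxU, h3⟩)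
    · have := (h0 x hxU).self_of_nhds
      linarith
  have hc0 : ∀ x, c x = 0 → a x = 0 ∧ b x = 0 := by
    intro x hx
    have h2 : ‖a x‖ ^ 2 = 0 := by
      simp only [c] at hx; nlinarith [sq_nonneg ‖a x‖, sq_nonneg (b x)]
    have h3 : b x ^ 2 = 0 := by
      simp only [c] at hx; nlinarith [sq_nonneg ‖a x‖, sq_nonneg (b x)]
    exact ⟨by simpa using h2, by simpa using h3⟩
  have hcc : Continuous c := by
    have := has.continuous
    have := hbs.continuous
    fun_prop
  let t : EuclideanSpace ℝ (Fin n) → ℝ := fun x => b x ^ 2 / c x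
  let k : EuclideanSpace ℝ (Fin n) → ℝ := fun x => b x / c x
  let p := fun x => proj (t x) (k x) (L (a x)) (L' (a x))
  have hpid : ∀ x, p x * p x = p x := by
    intro x
    refine proj_idem (hL (a x)) (hL' (a x)) ?_
    simp only [t, k]
    by_cases h : c x = 0
    · simp [h]
    · field_simp
      simp only [c]
      ring
  have hpc : Continuous p := by
    rw [continuous_iff_continuousAt]
    intro x
    have htk : ContinuousAt t x ∧ ContinuousAt k x := by
      by_cases hx : x ∈ Y
      · constructor
        · refine (continuousAt_const (y := (0:ℝ))).congr ?_
          filter_upwards [hb x hx] with y hy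
          simp [t, hy]
        · refine (continuousAt_const (y := (0:ℝ))).congr ?_
          filter_upwards [hb x hx] with y hy
          simp [k, hy]
      · have hcx : c x ≠ 0 := fun h => hab x hx (hc0 x h).1 (hc0 x h).2
        exact ⟨(hbs.continuous.continuousAt.pow 2).div hcc.continuousAt hcx,
          hbs.continuous.continuousAt.div hcc.continuousAt hcx⟩
    refine proj_continuousAt htk.1 htk.2 ?_ ?_
    · exact (L.continuous_of_finiteDimensional.comp has.continuous).continuousAt
    · exact (L'.continuous_of_finiteDimensional.comp has.continuous).continuousAt
  have hpY : ∀ x ∈ Y, ∀ v w, p x (v, w) = (v, 0) := by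
    intro x hx v w
    have := (hb x hx).self_of_nhds
    simp [p, proj_apply, t, k, this]
  let σ : EuclideanSpace ℝ (Fin n) → EuclideanSpace ℝ (Fin d) × EuclideanSpace ℝ (Fin d) :=
    fun x => (a x, b x • e)
  have hσs : ContDiff ℝ (⊤ : ℕ∞) σ := has.prodMk (hbs.smul contDiff_const)
  have hpσ : ∀ x, p x (σ x) = σ x := by
    intro x
    have h2 : L' (a x) (a x) = ‖a x‖ ^ 2 • e := by
      have := hL' (a x) e
      rwa [hLe] at this
    simp only [p, σ, proj_apply, map_smul, hLe, h2]
    by_cases h : c x = 0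
    · simp [t, k, h, hc0 x h]
    have e1 : k x * b x = t x := by simp only [k, t]; ring
    have e2 : t x * b x + k x * ‖a x‖ ^ 2 = b x := by
      simp only [k, t]
      field_simp
      simp only [c]; ring
    ext1
    · simp only
      linear_combination (norm := module) e1 • a x
    · simp only
      linear_combination (norm := module) e2 • e
  -- trivialisation
  obtain ⟨Ψ₀, hΨc₀, hΨu₀, hΨp₀⟩ := exists_triv (n := n) (p := fun z => p (WithLp.toLp 2 z + y₀))
    (hpc.comp (by fun_prop)) (fun z => hpid _)
  let Ψ := fun x : EuclideanSpace ℝ (Fin n) => Ψ₀ (WithLp.ofLp (x - y₀))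
  have hΨc : Continuous Ψ := hΨc₀.comp (by fun_prop)
  have hΨu : ∀ x, IsUnit (Ψ x) := fun x => hΨu₀ _
  have hΨp : ∀ x, p x * Ψ x = Ψ x * p y₀ := by
    intro x
    simpa [Ψ] using hΨp₀ (WithLp.ofLp (x - y₀))
  clear_value Ψ
  clear hΨp₀ hΨu₀ hΨc₀ Ψ₀
  have hΘc : Continuous (fun x => Ring.inverse (Ψ x)) := by
    rw [continuous_iff_continuousAt]
    intro x
    obtain ⟨u, hu⟩ := hΨu x
    have := NormedRing.inverse_continuousAt u
    rw [hu] at this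
    exact this.comp hΨc.continuousAt
  obtain ⟨A, hAs, hA, -⟩ := hΘc.exists_contDiff_approx ⊤
    (ε := fun x => 1 / (‖p y₀‖ * ‖Ψ x‖ + 1))
    (continuous_const.div (by fun_prop) (fun x => by positivity)) (fun x => by positivity)
  have inj : ∀ x v, p x v = v → (A x v).1 = 0 → v = 0 := by
    intro x v hv hAv
    obtain ⟨w, rfl⟩ : ∃ w, v = Ψ x w := ⟨Ring.inverse (Ψ x) v, by
      rw [← mul_apply_eq_comp, Ring.mul_inverse_cancel _ (hΨu x)]; rfl⟩
    have hinv : ∀ w, Ring.inverse (Ψ x) (Ψ x w) = w := fun w => by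
      rw [← mul_apply_eq_comp, Ring.inverse_mul_cancel _ (hΨu x)]; rfl
    have hw : p y₀ w = w := by
      have h2 : Ψ x (p y₀ w) = Ψ x w := by
        rw [← mul_apply_eq_comp, ← hΨp x, mul_apply_eq_comp, hv]
      rw [← hinv (p y₀ w), h2, hinv]
    have h3 : p y₀ (A x (Ψ x w)) = 0 := by
      have := hpY y₀ hy₀ (A x (Ψ x w)).1 (A x (Ψ x w)).2
      rw [hAv] at this
      rw [← Prod.mk.eta (p := A x (Ψ x w)), hAv, this]; rfl
    have h4 : w = - p y₀ ((A x - Ring.inverse (Ψ x)) (Ψ x w)) := by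
      rw [sub_apply, map_sub, h3, hinv, hw]; simp
    have h5 : ‖w‖ ≤ ‖p y₀‖ * (‖A x - Ring.inverse (Ψ x)‖ * (‖Ψ x‖ * ‖w‖)) := by
      conv_lhs => rw [h4, norm_neg]
      refine (ContinuousLinearMap.le_opNorm _ _).trans ?_
      gcongr
      refine (ContinuousLinearMap.le_opNorm _ _).trans ?_
      gcongr
      exact ContinuousLinearMap.le_opNorm _ _
    have h6 := hA x
    rw [dist_eq_norm, lt_div_iff₀ (by positivity)] at h6
    have h7 : ‖w‖ = 0 := by
      by_contra hne
      have hpos : 0 < ‖w‖ := lt_of_le_of_ne (norm_nonneg _) (Ne.symm hne)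
      have h8 := norm_nonneg (A x - Ring.inverse (Ψ x))
      nlinarith
    rw [norm_eq_zero.1 h7, map_zero]
  refine ⟨fun x => (A x (σ x)).1, (hAs.clm_apply hσs).fst, ?_, ?_⟩
  · ext x
    constructor
    · intro hx
      have h2 : σ x = 0 := by
        have h3 := (hb x hx).self_of_nhds
        have h4 := (haf x hx).self_of_nhds
        simp [σ, h3, h4, hYf x hx]
      simp [h2]
    · intro hx
      by_contra hxY
      have h2 := inj x (σ x) (hpσ x) hx
      have h3 : a x = 0 := congrArg Prod.fst h2
      have h4 : b x • e = 0 := congrArg Prod.snd h2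
      exact hab x hxY h3 ((smul_eq_zero.1 h4).resolve_right he)
  · intro x hx
    let T : EuclideanSpace ℝ (Fin d) →L[ℝ] EuclideanSpace ℝ (Fin d) :=
      ((ContinuousLinearMap.fst ℝ _ _).comp (A x)).comp (ContinuousLinearMap.inl ℝ _ _)
    have hTi : Function.Injective T := by
      rw [injective_iff_map_eq_zero]
      intro v hv
      have := inj x (v, 0) (hpY x hx v 0) hv
      exact congrArg Prod.fst this
    have hTs : Function.Surjective T :=
      (LinearMap.injective_iff_surjective (f := T.toLinearMap)).1 hTi
    have hfd : HasFDerivAt f (fderiv ℝ f x) x :=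
      ((hf.contDiffAt (hUopen.mem_nhds (hYU hx))).differentiableAt (by simp)).hasFDerivAt
    have hσd : HasFDerivAt σ ((ContinuousLinearMap.inl ℝ _ _).comp (fderiv ℝ f x)) x := by
      have h2 : HasFDerivAt (fun y => (ContinuousLinearMap.inl ℝ (EuclideanSpace ℝ (Fin d))
          (EuclideanSpace ℝ (Fin d))) (f y))
          ((ContinuousLinearMap.inl ℝ _ _).comp (fderiv ℝ f x)) x :=
        (ContinuousLinearMap.inl ℝ (EuclideanSpace ℝ (Fin d))
          (EuclideanSpace ℝ (Fin d))).hasFDerivAt.comp x hfd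
      refine h2.congr_of_eventuallyEq ?_
      filter_upwards [hb x hx, haf x hx] with y hy hy'
      simp [σ, hy, hy']
    have hσ0 : σ x = 0 := by
      have h3 := (hb x hx).self_of_nhds
      have h4 := (haf x hx).self_of_nhds
      simp [σ, h3, h4, hYf x hx]
    have hAd : HasFDerivAt A (fderiv ℝ A x) x :=
      (hAs.differentiable (by simp) x).hasFDerivAt
    have hF : HasFDerivAt (fun x => (A x (σ x)).1) (T.comp (fderiv ℝ f x)) x := by
      refine (hAd.clm_apply hσd).fst.congr_fderiv ?_
      refine ContinuousLinearMap.ext fun v => ?_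
      simp [T, hσ0]
    rw [hF.fderiv]
    exact hTs.comp (hfsurj x hx)

end DCI

/-- **Theorem 2.3** (after Bochnak–Kucharz). Let `d ∈ {1,2,4,8}`, `n ≥ 1`. If a closed set
`Y ⊆ ℝⁿ` is defined, on an open neighborhood `U` of `Y`, as the zero set of a `C^∞` map
`f : U → ℝᵈ` whose derivative is surjective at each point of `Y`, then `Y` is a
differentiable complete intersection in `ℝⁿ`: there is a global `C^∞` map `F : ℝⁿ → ℝᵈ`
with `Y = F⁻¹(0)` and surjective derivative at each point of `Y`. -/
theorem differentiable_complete_intersection_euclidean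
    (d n : ℕ) (hd : d ∈ ({1, 2, 4, 8} : Set ℕ)) (hn : 1 ≤ n)
    (Y U : Set (EuclideanSpace ℝ (Fin n)))
    (hYclosed : IsClosed Y) (hUopen : IsOpen U) (hYU : Y ⊆ U)
    (f : EuclideanSpace ℝ (Fin n) → EuclideanSpace ℝ (Fin d))
    (hf : ContDiffOn ℝ (⊤ : ℕ∞) f U)
    (hYzero : Y = {x ∈ U | f x = 0})
    (hfsurj : ∀ x ∈ Y, Function.Surjective (fderiv ℝ f x)) :
    ∃ F : EuclideanSpace ℝ (Fin n) → EuclideanSpace ℝ (Fin d),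
      ContDiff ℝ (⊤ : ℕ∞) F ∧
      Y = {x | F x = 0} ∧
      ∀ x ∈ Y, Function.Surjective (fderiv ℝ F x) := by
  exact DCI.main (DCI.hasMul_of_mem hd) Y U hYclosed hUopen hYU f hf hYzero hfsurj
end

section
/- Let d ∈ {1, 2, 4, 8}. There exists a continuous map A from ℝᵈ ∖ {0} to the d×d real matrices such that for every v ∈ ℝᵈ ∖ {0}, the matrix A(v) is invertible and its first column equals v (that is, A(v)·e₁ = v, where e₁ = (1,0,…,0)ᵗ). -/
/-- A continuous matrix map with `Aᵀ A = |v|² I` and first column `v` does the job. -/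
theorem clutching_aux {d : ℕ} (A : (Fin d → ℝ) → Matrix (Fin d) (Fin d) ℝ)
    (hc : Continuous A)
    (h : ∀ v, (A v).transpose * A v = (∑ i, v i ^ 2) • (1 : Matrix (Fin d) (Fin d) ℝ))
    (h1 : ∀ v, (A v).mulVec (fun i => if (i : ℕ) = 0 then 1 else 0) = v) :
    ∃ A : (Fin d → ℝ) → Matrix (Fin d) (Fin d) ℝ,
      ContinuousOn A {v | v ≠ 0} ∧
      ∀ v : Fin d → ℝ, v ≠ 0 →
        IsUnit (A v) ∧
        (A v).mulVec (fun i => if (i : ℕ) = 0 then 1 else 0) = v := by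
  refine ⟨A, hc.continuousOn, fun v hv => ⟨?_, h1 v⟩⟩
  have hs : (∑ i, v i ^ 2) ≠ 0 := by
    intro h0
    apply hv
    funext i
    rw [Finset.sum_eq_zero_iff_of_nonneg (fun i _ => sq_nonneg (v i))] at h0
    simpa using h0 i (Finset.mem_univ i)
  refine (Matrix.isUnit_iff_isUnit_det _).2
    (Matrix.isUnit_det_of_left_inverse (B := (∑ i, v i ^ 2)⁻¹ • (A v).transpose) ?_)
  rw [Matrix.smul_mul, h v, smul_smul, inv_mul_cancel₀ hs, one_smul]

/-- The matrix-valued clutching map from the proof of Theorem 2.3. For `d ∈ {1,2,4,8}`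
there is a continuous map `A` on `ℝᵈ ∖ {0}` with values in invertible `d × d` real
matrices such that the first column of `A v` equals `v`, i.e. `A v · e₁ = v` where
`e₁ = (1,0,…,0)ᵗ`. -/
theorem exists_continuous_invertible_matrix_with_first_column
    (d : ℕ) (hd : d ∈ ({1, 2, 4, 8} : Set ℕ)) :
    ∃ A : (Fin d → ℝ) → Matrix (Fin d) (Fin d) ℝ,
      ContinuousOn A {v | v ≠ 0} ∧
      ∀ v : Fin d → ℝ, v ≠ 0 →
        IsUnit (A v) ∧
        (A v).mulVec (fun i => if (i : ℕ) = 0 then 1 else 0) = v := by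
  rcases hd with rfl | rfl | rfl | rfl
  · refine clutching_aux (fun v => !![v 0]) ?_ ?_ ?_
    · refine continuous_matrix fun i j => ?_
      fin_cases i <;> fin_cases j <;> simp <;> fun_prop
    · intro v
      ext i j
      fin_cases i <;> fin_cases j <;>
        simp [Matrix.mul_apply, Fin.sum_univ_succ] <;> ring
    · intro v
      ext i
      fin_cases i <;> simp [Matrix.mulVec, dotProduct, Fin.sum_univ_succ]
  · refine clutching_aux (fun v => !![v 0, -v 1;
      v 1, v 0]) ?_ ?_ ?_
    · refine continuous_matrix fun i j => ?_
      fin_cases i <;> fin_cases j <;> simp <;> fun_prop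
    · intro v
      ext i j
      fin_cases i <;> fin_cases j <;>
        simp [Matrix.mul_apply, Fin.sum_univ_succ] <;> ring
    · intro v
      ext i
      fin_cases i <;> simp [Matrix.mulVec, dotProduct, Fin.sum_univ_succ]
  · refine clutching_aux (fun v => !![v 0, -v 1, -v 2, -v 3;
      v 1, v 0, -v 3, v 2;
      v 2, v 3, v 0, -v 1;
      v 3, -v 2, v 1, v 0]) ?_ ?_ ?_
    · refine continuous_matrix fun i j => ?_
      fin_cases i <;> fin_cases j <;> simp <;> fun_prop
    · intro v
      ext i j
      fin_cases i <;> fin_cases j <;>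
        simp [Matrix.mul_apply, Fin.sum_univ_succ] <;> ring
    · intro v
      ext i
      fin_cases i <;> simp [Matrix.mulVec, dotProduct, Fin.sum_univ_succ]
  · refine clutching_aux (fun v => !![v 0, -v 1, -v 2, -v 3, -v 4, -v 5, -v 6, -v 7;
      v 1, v 0, -v 3, v 2, -v 5, v 4, v 7, -v 6;
      v 2, v 3, v 0, -v 1, -v 6, -v 7, v 4, v 5;
      v 3, -v 2, v 1, v 0, -v 7, v 6, -v 5, v 4;
      v 4, v 5, v 6, v 7, v 0, -v 1, -v 2, -v 3;
      v 5, -v 4, v 7, -v 6, v 1, v 0, v 3, -v 2;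
      v 6, -v 7, -v 4, v 5, v 2, -v 3, v 0, v 1;
      v 7, v 6, -v 5, -v 4, v 3, v 2, -v 1, v 0]) ?_ ?_ ?_
    · refine continuous_matrix fun i j => ?_
      fin_cases i <;> fin_cases j <;> simp <;> fun_prop
    · intro v
      ext i j
      fin_cases i <;> fin_cases j <;>
        simp [Matrix.mul_apply, Fin.sum_univ_succ] <;> ring
    · intro v
      ext i
      fin_cases i <;> simp [Matrix.mulVec, dotProduct, Fin.sum_univ_succ]
end

section
/- Let d ≥ 2 and let Σ ⊆ ℂᵈ be a closed discrete subset which is tame and does not contain the origin. Then for each r ∈ ℕ there exists an injective holomorphic map F : ℂᵈ → ℂᵈ whose image is disjoint from Σ, such that F(0) = 0 and F is tangent to the identity at 0 to order r. -/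
open Function Set

/-- We write `ℂᵈ = ℂ^{d-1} × ℂ`, `z = (z', z_d)`, where `ℂ^{d-1}` carries the Euclidean
norm. -/
noncomputable abbrev ComplexEuclideanSplit (d : ℕ) : Type :=
  EuclideanSpace ℂ (Fin (d - 1)) × ℂ

/-- The set `Γ = {(z', z_d) ∈ ℂ^{d-1} × ℂ : |z_d| ≤ 1 + ‖z'‖}` of Definition 1. -/
def GammaSet (d : ℕ) : Set (ComplexEuclideanSplit d) :=
  {z | ‖z.2‖ ≤ 1 + ‖z.1‖}

/-- **Definition 1.** A subset `Σ ⊆ ℂᵈ` is tame if there is a holomorphic automorphism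
`Φ` of `ℂᵈ` (a bijective holomorphic map with holomorphic inverse) such that
`Φ(Σ) ⊆ Γ`. -/
def IsTame (d : ℕ) (S : Set (ComplexEuclideanSplit d)) : Prop :=
  ∃ Φ Ψ : ComplexEuclideanSplit d → ComplexEuclideanSplit d,
    Differentiable ℂ Φ ∧ Differentiable ℂ Ψ ∧
    LeftInverse Ψ Φ ∧ RightInverse Ψ Φ ∧
    Φ '' S ⊆ GammaSet d

open Metric Filter Topology

section PartOne
variable {E F : Type} [NormedAddCommGroup E] [NormedSpace ℂ E]
  [NormedAddCommGroup F] [NormedSpace ℂ F]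

theorem fb_cauchy_est {f : E → F} {x : E} {R M : ℝ} (hR : 0 < R)
    (hf : DifferentiableOn ℂ f (ball x R)) (hM : ∀ z ∈ ball x R, ‖f z‖ ≤ M) :
    ‖fderiv ℂ f x‖ ≤ M / (R / 2) := by
  have hM0 : 0 ≤ M := (norm_nonneg _).trans (hM x (mem_ball_self hR))
  refine ContinuousLinearMap.opNorm_le_bound _ (by positivity) fun v => ?_
  by_cases hv : v = 0
  · simp [hv]
  have hv' : 0 < ‖v‖ := norm_pos_iff.2 hv
  set s : ℝ := R / 2 / ‖v‖ with hs
  have hs0 : 0 < s := by positivity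
  have hmem : ∀ t ∈ closedBall (0 : ℂ) s, x + t • v ∈ ball x R := by
    intro t ht
    rw [mem_closedBall_zero_iff] at ht
    rw [mem_ball_iff_norm, add_sub_cancel_left, norm_smul]
    calc ‖t‖ * ‖v‖ ≤ s * ‖v‖ := by gcongr
      _ = R / 2 := by rw [hs]; field_simp
      _ < R := by linarith
  have hline : ∀ t : ℂ, HasDerivAt (fun t : ℂ => x + t • v) v t := fun t => by
    simpa using ((hasDerivAt_id t).smul_const v).const_add x
  have hdiff : DifferentiableOn ℂ (fun t : ℂ => f (x + t • v)) (closedBall 0 s) := by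
    intro t ht
    have h1 : DifferentiableAt ℂ f (x + t • v) :=
      hf.differentiableAt (isOpen_ball.mem_nhds (hmem t ht))
    exact (h1.comp t (hline t).differentiableAt).differentiableWithinAt
  have hd : DiffContOnCl ℂ (fun t : ℂ => f (x + t • v)) (ball 0 s) := by
    apply DifferentiableOn.diffContOnCl
    rwa [closure_ball _ hs0.ne']
  have h2 : HasDerivAt (fun t : ℂ => f (x + t • v)) (fderiv ℂ f x v) 0 := by
    have h1 : HasFDerivAt f (fderiv ℂ f x) (x + (0 : ℂ) • v) := by
      rw [zero_smul, add_zero]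
      exact (hf.differentiableAt (isOpen_ball.mem_nhds (mem_ball_self hR))).hasFDerivAt
    exact h1.comp_hasDerivAt (0 : ℂ) (hline 0)
  have h3 := Complex.norm_deriv_le_of_forall_mem_sphere_norm_le hs0 hd
    (fun t ht => hM _ (hmem t (sphere_subset_closedBall ht)))
  rw [h2.deriv] at h3
  calc _ ≤ M / s := h3
    _ = M / (R / 2) * ‖v‖ := by rw [hs]; field_simp

theorem fb_weierstrass [CompleteSpace F] {f : ℕ → E → F} {g : E → F} {U : Set E} (hU : IsOpen U)
    (hf : ∀ n, DifferentiableOn ℂ (f n) U) (hfg : TendstoUniformlyOn f g atTop U) :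
    DifferentiableOn ℂ g U := by
  intro x hx
  obtain ⟨R, hR, hRU⟩ := Metric.isOpen_iff.1 hU x hx
  have hsub : ∀ y ∈ ball x (R / 2), ball y (R / 2) ⊆ U := by
    intro y hy
    refine (ball_subset_ball' ?_).trans hRU
    rw [mem_ball] at hy
    linarith
  have hC : UniformCauchySeqOn (fun n => fderiv ℂ (f n)) atTop (ball x (R / 2)) := by
    rw [Metric.uniformCauchySeqOn_iff]
    intro ε hε
    obtain ⟨N, hN⟩ := (Metric.uniformCauchySeqOn_iff.1 hfg.uniformCauchySeqOn)
      (ε * (R / 8)) (by positivity)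
    refine ⟨N, fun m hm n hn y hy => ?_⟩
    have hyU : y ∈ U := hsub y hy (mem_ball_self (by linarith))
    have h1 := fb_cauchy_est (f := fun z => f m z - f n z) (x := y) (R := R / 2)
      (M := ε * (R / 8)) (by linarith) (((hf m).sub (hf n)).mono (hsub y hy))
      (fun z hz => by
        have := hN m hm n hn z (hsub y hy hz)
        rw [dist_eq_norm] at this
        exact this.le)
    rw [fderiv_fun_sub ((hf m).differentiableAt (hU.mem_nhds hyU))
      ((hf n).differentiableAt (hU.mem_nhds hyU))] at h1
    rw [dist_eq_norm]
    calc _ ≤ _ := h1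
      _ = ε / 2 := by field_simp; norm_num
      _ < ε := by linarith
  have hlim : ∀ y ∈ ball x (R / 2), ∃ L, Tendsto (fun n => fderiv ℂ (f n) y) atTop (𝓝 L) := by
    intro y hy
    exact cauchySeq_tendsto_of_complete (hC.cauchySeq hy)
  choose! g' hg' using hlim
  have hT : TendstoUniformlyOn (fun n => fderiv ℂ (f n)) g' atTop (ball x (R / 2)) :=
    hC.tendstoUniformlyOn_of_tendsto hg'
  have := hasFDerivAt_of_tendstoUniformlyOn (f := f) (g := g) isOpen_ball hT
    (fun n y hy => ((hf n).differentiableAt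
      (hU.mem_nhds (hsub y hy (mem_ball_self (by linarith))))).hasFDerivAt)
    (fun y hy => hfg.tendsto_at (hsub y hy (mem_ball_self (by linarith))))
    (mem_ball_self (by linarith))
  exact this.differentiableAt.differentiableWithinAt

theorem fb_fderiv_differentiable [FiniteDimensional ℂ E] [CompleteSpace F] {f : E → F}
    (hf : Differentiable ℂ f) : Differentiable ℂ (fderiv ℂ f) := by
  have key : ∀ v : E, Differentiable ℂ (fun z => fderiv ℂ f z v) := by
    intro v x
    have : ProperSpace E := FiniteDimensional.proper ℂ E
    obtain ⟨M, hM⟩ := (isCompact_closedBall x 5).exists_bound_of_continuousOn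
      hf.continuous.continuousOn
    have hM0 : 0 ≤ M := (norm_nonneg _).trans (hM x (by simp))
    have hd1 : ∀ y ∈ ball x 3, ‖fderiv ℂ f y‖ ≤ M := by
      intro y hy
      have := fb_cauchy_est (f := f) (x := y) (R := 2) (M := M) (by norm_num)
        hf.differentiableOn (fun z hz => hM z (by
          rw [mem_ball] at *
          rw [mem_closedBall]
          linarith [dist_triangle z y x]))
      simpa using this
    have hlip : ∀ y ∈ ball x 3, ∀ z ∈ ball x 3, ‖f z - f y‖ ≤ M * ‖z - y‖ := by
      intro y hy z hz
      let _ : NormedSpace ℝ E := NormedSpace.restrictScalars ℝ ℂ E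
      let _ : NormedSpace ℝ F := NormedSpace.restrictScalars ℝ ℂ F
      exact (convex_ball x 3).norm_image_sub_le_of_norm_fderiv_le (𝕜 := ℂ)
        (fun w _ => hf w) hd1 hy hz
    have hlip' : ∀ y ∈ ball x 1, ∀ z ∈ ball x 2, ‖fderiv ℂ f z - fderiv ℂ f y‖ ≤
        2 * M * ‖z - y‖ := by
      intro y hy z hz
      have h1 := fb_cauchy_est (f := fun w => f (w + (z - y)) - f w) (x := y) (R := 1)
        (M := M * ‖z - y‖) (by norm_num)
        ((hf.comp (differentiable_id.add_const _)).sub hf).differentiableOn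
        (fun w hw => by
          have := hlip w (by
            rw [mem_ball] at *
            linarith [dist_triangle w y x]) (w + (z - y)) (by
            rw [mem_ball_iff_norm] at *
            calc ‖w + (z - y) - x‖ = ‖(w - y) + (z - x)‖ := by congr 1; abel
              _ ≤ _ := norm_add_le _ _
              _ < 3 := by linarith)
          simpa using this)
      have hs1 : DifferentiableAt ℂ (fun w => f (w + (z - y))) y :=
        (hf.comp (differentiable_id.add_const (z - y))) y
      rw [fderiv_fun_sub hs1 (hf y), fderiv_comp_add_right] at h1
      simp only [add_sub_cancel] at h1
      calc _ ≤ _ := h1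
        _ = _ := by ring
    have hT : TendstoUniformlyOn (fun (n : ℕ) z => ((n : ℂ) + 1) • (f (z + ((n : ℂ) + 1)⁻¹ • v) - f z))
        (fun z => fderiv ℂ f z v) (atTop) (ball x 1) := by
      rw [Metric.tendstoUniformlyOn_iff]
      intro ε hε
      have hev : ∀ᶠ n : ℕ in atTop, ‖v‖ * (1 / ((n : ℝ) + 1)) < 1 :=
        ((tendsto_one_div_add_atTop_nhds_zero_nat (𝕜 := ℝ)).const_mul ‖v‖).eventually_lt_const
          (by simp)
      have hev2 : ∀ᶠ n : ℕ in atTop, (2 * M * ‖v‖ * ‖v‖) * (1 / ((n : ℝ) + 1)) < ε :=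
        ((tendsto_one_div_add_atTop_nhds_zero_nat (𝕜 := ℝ)).const_mul _).eventually_lt_const
          (by simpa using hε)
      filter_upwards [hev, hev2] with n hn hn2 z hz
      have hn0 : (0 : ℝ) < (n : ℝ) + 1 := by positivity
      have hnc : ((n : ℂ) + 1) ≠ 0 := by exact_mod_cast hn0.ne'
      have hnorm : ‖((n : ℂ) + 1)‖ = (n : ℝ) + 1 := by
        have : ((n : ℂ) + 1) = ((n + 1 : ℕ) : ℂ) := by push_cast; rfl
        rw [this, Complex.norm_natCast]; push_cast; rfl
      set h : E := ((n : ℂ) + 1)⁻¹ • v with hh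
      have hhn : ‖h‖ = ‖v‖ * (1 / ((n : ℝ) + 1)) := by
        rw [hh, norm_smul, norm_inv, hnorm]; ring
      have hmv : ‖f (z + h) - f z - fderiv ℂ f z (z + h - z)‖ ≤ (2 * M * ‖h‖) * ‖z + h - z‖ := by
        let _ : NormedSpace ℝ E := NormedSpace.restrictScalars ℝ ℂ E
        let _ : NormedSpace ℝ F := NormedSpace.restrictScalars ℝ ℂ F
        refine (convex_segment z (z + h)).norm_image_sub_le_of_norm_fderiv_le' (𝕜 := ℂ)
          (fun w _ => hf w) ?_ (left_mem_segment ℝ _ _) (right_mem_segment ℝ _ _)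
        intro w hw
        have hwz : ‖w - z‖ ≤ ‖h‖ := by
          rw [segment_eq_image'] at hw
          obtain ⟨t, ht, rfl⟩ := hw
          simp only [add_sub_cancel_left]
          rw [norm_smul, Real.norm_of_nonneg ht.1]
          nlinarith [norm_nonneg h, ht.2]
        refine (hlip' z hz w ?_).trans (by gcongr)
        rw [mem_ball_iff_norm] at *
        have : ‖w - x‖ ≤ ‖w - z‖ + ‖z - x‖ := norm_sub_le_norm_sub_add_norm_sub _ _ _
        linarith
      simp only [add_sub_cancel_left] at hmv
      have hv : fderiv ℂ f z v = ((n : ℂ) + 1) • fderiv ℂ f z h := by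
        rw [hh, map_smul, smul_smul, mul_inv_cancel₀ hnc, one_smul]
      rw [dist_comm, dist_eq_norm, hv, ← smul_sub, norm_smul, hnorm]
      calc _ ≤ ((n : ℝ) + 1) * ((2 * M * ‖h‖) * ‖h‖) := by gcongr
        _ = (2 * M * ‖v‖ * ‖v‖) * (1 / ((n : ℝ) + 1)) := by rw [hhn]; field_simp
        _ < ε := hn2
    refine (fb_weierstrass isOpen_ball (fun n => ?_) hT).differentiableAt (ball_mem_nhds x one_pos)
    exact (((hf.comp (differentiable_id.add_const _)).sub hf).const_smul _).differentiableOn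
  let d := Module.finrank ℂ E
  have hd : d = Module.finrank ℂ (Fin d → ℂ) := (Module.finrank_fin_fun ℂ).symm
  let e₁ := ContinuousLinearEquiv.ofFinrankEq hd
  let e₂ := (e₁.arrowCongr (1 : F ≃L[ℂ] F)).trans (ContinuousLinearEquiv.piRing (Fin d))
  rw [← Function.id_comp (fderiv ℂ f), ← e₂.symm_comp_self]
  refine e₂.symm.differentiable.comp ?_
  refine differentiable_pi.2 fun i => ?_
  exact key _

theorem fb_iterated_zero [FiniteDimensional ℂ E] (k : ℕ) : ∀ {F : Type} [NormedAddCommGroup F]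
    [NormedSpace ℂ F] [CompleteSpace F] {f : E → F}, Differentiable ℂ f →
    (∃ C, ∃ ρ > 0, ∀ z, ‖z‖ < ρ → ‖f z‖ ≤ C * ‖z‖ ^ (k + 1)) → iteratedFDeriv ℂ k f 0 = 0 := by
  induction k with
  | zero =>
    intro F _ _ _ f hf ⟨C, ρ, hρ, h⟩
    ext m
    have := h 0 (by simpa using hρ)
    simpa using this
  | succ k ih =>
    intro F _ _ _ f hf ⟨C, ρ, hρ, h⟩
    have h0 : iteratedFDeriv ℂ k (fderiv ℂ f) 0 = 0 := by
      refine ih (fb_fderiv_differentiable hf) ?_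
      refine ⟨C * 2 ^ (k + 2) * 2, ρ / 2, by positivity, fun z hz => ?_⟩
      by_cases hz0 : z = 0
      · subst hz0
        have hO : HasFDerivAt f (0 : E →L[ℂ] F) 0 := by
          have hf0 : f 0 = 0 := by
            have := h 0 (by simpa using hρ)
            simpa using this
          rw [hasFDerivAt_iff_isLittleO_nhds_zero]
          simp only [zero_add, hf0, sub_zero, _root_.zero_apply]
          have h1 : f =O[𝓝 0] (fun z : E => ‖z‖ ^ (k + 1 + 1)) := by
            refine Asymptotics.IsBigO.of_bound C ?_
            filter_upwards [ball_mem_nhds (0 : E) hρ] with z hz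
            have := h z (by simpa using hz)
            simpa using this
          refine h1.trans_isLittleO ?_
          exact Asymptotics.isLittleO_norm_pow_id (by omega)
        rw [hO.fderiv]; simp
      · have hzp : 0 < ‖z‖ := norm_pos_iff.2 hz0
        have hb : ∀ w ∈ ball z ‖z‖, ‖w‖ < 2 * ‖z‖ := by
          intro w hw
          rw [mem_ball_iff_norm] at hw
          have : ‖w‖ ≤ ‖w - z‖ + ‖z‖ := by simpa using norm_add_le (w - z) z
          linarith
        have hC : 0 ≤ C := by
          have := (norm_nonneg _).trans (h z (by linarith))
          exact nonneg_of_mul_nonneg_left this (by positivity)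
        have := fb_cauchy_est (f := f) (x := z) (R := ‖z‖) (M := C * (2 * ‖z‖) ^ (k + 1 + 1))
          hzp hf.differentiableOn (fun w hw => by
            have hw' := hb w hw
            refine (h w (by linarith)).trans ?_
            gcongr)
        refine this.trans (le_of_eq ?_)
        field_simp
        ring
    ext m
    rw [iteratedFDeriv_succ_apply_right, h0]
    simp

end PartOne

section PartTwo
variable {E : Type} [NormedAddCommGroup E] [NormedSpace ℂ E]

/-- the approximating sequence `B^n (2^{-n} z)` -/
noncomputable def fbSeq (B : E → E) : ℕ → E → E
  | 0, z => z
  | n + 1, z => B (fbSeq B n ((2⁻¹ : ℂ) • z))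

theorem fb_norm_half (z : E) : ‖(2⁻¹ : ℂ) • z‖ = ‖z‖ / 2 := by
  rw [norm_smul, norm_inv, Complex.norm_ofNat]; ring

theorem fb_half_pow (z : E) {q : ℕ} (hq : 2 ≤ q) : ‖(2⁻¹ : ℂ) • z‖ ^ q ≤ ‖z‖ ^ q / 4 := by
  rw [fb_norm_half, div_pow]
  have : (4 : ℝ) ≤ 2 ^ q := by
    calc (4 : ℝ) = 2 ^ 2 := by norm_num
      _ ≤ 2 ^ q := pow_le_pow_right₀ (by norm_num) hq
  gcongr

theorem fb_exists_induct {P : E → Prop} {ρ : ℝ} (hρ : 0 < ρ) (h1 : ∀ z, ‖z‖ < ρ → P z)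
    (h2 : ∀ z, P ((2⁻¹ : ℂ) • z) → P z) (z : E) : P z := by
  have key : ∀ m : ℕ, ∀ z : E, ‖z‖ < 2 ^ m * ρ → P z := by
    intro m
    induction m with
    | zero => intro z hz; exact h1 z (by simpa using hz)
    | succ m ih =>
      intro z hz
      refine h2 z (ih _ ?_)
      rw [fb_norm_half]
      rw [pow_succ] at hz
      linarith
  obtain ⟨m, hm⟩ := pow_unbounded_of_one_lt (‖z‖ / ρ) (one_lt_two)
  exact key m z ((div_lt_iff₀ hρ).1 hm)

theorem fb_limit [CompleteSpace E] {B : E → E} (hBd : Differentiable ℂ B)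
    (hBs : ContDiff ℂ 1 B) (hBi : Function.Injective B)
    {C : ℝ} (hC : 0 ≤ C) {q : ℕ} (hq : 2 ≤ q)
    (hB : ∀ z, ‖z‖ ≤ 1 → ‖B z - (2 : ℂ) • z‖ ≤ C * ‖z‖ ^ q) :
    ∃ G : E → E, Differentiable ℂ G ∧ Function.Injective G ∧
      (∃ C, ∃ ρ > 0, ∀ z, ‖z‖ < ρ → ‖G z - z‖ ≤ C * ‖z‖ ^ q) ∧
      ∀ z, G z = B (G ((2⁻¹ : ℂ) • z)) := by
  have hB0 : B 0 = 0 := by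
    have := hB 0 (by simp)
    simpa [show q ≠ 0 by omega] using this
  -- Lipschitz
  have hD : HasFDerivAt B ((2 : ℂ) • ContinuousLinearMap.id ℂ E) 0 := by
    rw [hasFDerivAt_iff_isLittleO_nhds_zero]
    simp only [zero_add, hB0, sub_zero]
    have h1 : (fun z : E => B z - ((2 : ℂ) • ContinuousLinearMap.id ℂ E) z)
        =O[𝓝 0] (fun z : E => ‖z‖ ^ q) := by
      refine Asymptotics.IsBigO.of_bound C ?_
      filter_upwards [closedBall_mem_nhds (0 : E) one_pos] with z hz
      have := hB z (by simpa using hz)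
      simpa using this
    exact h1.trans_isLittleO (Asymptotics.isLittleO_norm_pow_id (by omega))
  have hS : HasStrictFDerivAt B ((2 : ℂ) • ContinuousLinearMap.id ℂ E) 0 :=
    hBs.contDiffAt.hasStrictFDerivAt' hD one_ne_zero
  obtain ⟨s, hs, hLs⟩ := hS.exists_lipschitzOnWith_of_nnnorm_lt 3 (by
    rw [← NNReal.coe_lt_coe, coe_nnnorm]
    have h1 : ‖(2 : ℂ) • ContinuousLinearMap.id ℂ E‖ ≤ 2 := by
      rw [norm_smul, Complex.norm_ofNat]
      have := ContinuousLinearMap.norm_id_le (𝕜 := ℂ) (E := E)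
      linarith
    refine h1.trans_lt ?_
    norm_num)
  obtain ⟨δ, hδ, hδs⟩ := Metric.nhds_basis_closedBall.mem_iff.1 hs
  have hL : ∀ x y : E, ‖x‖ ≤ δ → ‖y‖ ≤ δ → ‖B x - B y‖ ≤ 3 * ‖x - y‖ := by
    intro x y hx hy
    have := hLs.norm_sub_le (hδs (by simpa using hx)) (hδs (by simpa using hy))
    simpa using this
  set ρ : ℝ := min (min δ 1) (1 / (2 * C + 1)) with hρdef
  have hρ : 0 < ρ := by positivity
  have hρδ : ρ ≤ δ := (min_le_left _ _).trans (min_le_left _ _)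
  have hρ1 : ρ ≤ 1 := (min_le_left _ _).trans (min_le_right _ _)
  have hρC : 2 * C * ρ ≤ 1 := by
    have h1 : ρ ≤ 1 / (2 * C + 1) := min_le_right _ _
    rw [le_div_iff₀ (by positivity)] at h1
    nlinarith
  have hpow : ∀ z : E, ‖z‖ ≤ ρ → 2 * C * ‖z‖ ^ q ≤ ‖z‖ := by
    intro z hz
    have h1 : ‖z‖ ^ q ≤ ‖z‖ ^ 2 :=
      pow_le_pow_of_le_one (norm_nonneg _) (hz.trans hρ1) hq
    calc 2 * C * ‖z‖ ^ q ≤ 2 * C * ‖z‖ ^ 2 := by gcongr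
      _ = (2 * C * ‖z‖) * ‖z‖ := by ring
      _ ≤ (2 * C * ρ) * ‖z‖ := by gcongr
      _ ≤ 1 * ‖z‖ := by gcongr
      _ = ‖z‖ := one_mul _
  have hhalf : ∀ z : E, ‖z‖ ≤ ρ → ‖(2⁻¹ : ℂ) • z‖ ≤ ρ := by
    intro z hz
    rw [fb_norm_half]
    linarith [norm_nonneg z]
  have hnear : ∀ u h : E, ‖h‖ ≤ ρ → ‖u - h‖ ≤ 2 * C * ‖h‖ ^ q → ‖u‖ ≤ 2 * ‖h‖ := by
    intro u h hh hu
    have : ‖u‖ ≤ ‖u - h‖ + ‖h‖ := by simpa using norm_add_le (u - h) h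
    linarith [hpow h hh]
  have lem1 : ∀ n : ℕ, ∀ z : E, ‖z‖ ≤ ρ → ‖fbSeq B n z - z‖ ≤ 2 * C * ‖z‖ ^ q := by
    intro n
    induction n with
    | zero => intro z hz; simp only [fbSeq, sub_self, norm_zero]; positivity
    | succ n ih =>
      intro z hz
      have h1 := ih _ (hhalf z hz)
      set u := fbSeq B n ((2⁻¹ : ℂ) • z) with hu
      have h2 : ‖u‖ ≤ ‖z‖ := by
        have := hnear u _ (hhalf z hz) h1
        rw [fb_norm_half] at this
        linarith
      have h3 := hB u (by linarith)
      have h4 := fb_half_pow z hq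
      have h5 : fbSeq B (n + 1) z - z = (B u - (2 : ℂ) • u) + (2 : ℂ) • (u - (2⁻¹ : ℂ) • z) := by
        rw [smul_sub, smul_smul, mul_inv_cancel₀ two_ne_zero, one_smul]
        simp only [fbSeq, ← hu]
        abel
      rw [h5]
      calc _ ≤ ‖B u - (2 : ℂ) • u‖ + ‖(2 : ℂ) • (u - (2⁻¹ : ℂ) • z)‖ := norm_add_le _ _
        _ = ‖B u - (2 : ℂ) • u‖ + 2 * ‖u - (2⁻¹ : ℂ) • z‖ := by
            rw [norm_smul, Complex.norm_ofNat]
        _ ≤ C * ‖u‖ ^ q + 2 * (2 * C * ‖(2⁻¹ : ℂ) • z‖ ^ q) := by gcongr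
        _ ≤ C * ‖z‖ ^ q + 2 * (2 * C * (‖z‖ ^ q / 4)) := by gcongr
        _ = _ := by ring
  have lem1' : ∀ n : ℕ, ∀ z : E, ‖z‖ ≤ ρ → ‖fbSeq B n ((2⁻¹ : ℂ) • z)‖ ≤ δ := by
    intro n z hz
    have := hnear _ _ (hhalf z hz) (lem1 n _ (hhalf z hz))
    rw [fb_norm_half] at this
    linarith
  have lem2 : ∀ n : ℕ, ∀ z : E, ‖z‖ ≤ ρ →
      ‖fbSeq B (n + 1) z - fbSeq B n z‖ ≤ 2 * C * (3 / 4) ^ n * ‖z‖ ^ q := by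
    intro n
    induction n with
    | zero => intro z hz; simpa [fbSeq] using lem1 1 z hz
    | succ n ih =>
      intro z hz
      have h1 := hL _ _ (lem1' (n + 1) z hz) (lem1' n z hz)
      have h2 := ih _ (hhalf z hz)
      have h4 := fb_half_pow z hq
      calc _ ≤ 3 * ‖fbSeq B (n + 1) ((2⁻¹ : ℂ) • z) - fbSeq B n ((2⁻¹ : ℂ) • z)‖ := h1
        _ ≤ 3 * (2 * C * (3 / 4) ^ n * ‖(2⁻¹ : ℂ) • z‖ ^ q) := by gcongr
        _ ≤ 3 * (2 * C * (3 / 4) ^ n * (‖z‖ ^ q / 4)) := by gcongr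
        _ = _ := by rw [pow_succ]; ring
  have lem3 : ∀ z : E, ‖z‖ ≤ ρ → ∀ n,
      dist (fbSeq B n z) (fbSeq B (n + 1) z) ≤ 2 * C * (3 / 4) ^ n := by
    intro z hz n
    rw [dist_comm, dist_eq_norm]
    refine (lem2 n z hz).trans ?_
    have : ‖z‖ ^ q ≤ 1 := pow_le_one₀ (norm_nonneg _) (hz.trans hρ1)
    have h0 : 0 ≤ 2 * C * (3 / 4) ^ n := by positivity
    nlinarith
  have hlim : ∀ z : E, ∃ L, Tendsto (fun n => fbSeq B n z) atTop (𝓝 L) := by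
    refine fb_exists_induct hρ ?_ ?_
    · intro z hz
      exact cauchySeq_tendsto_of_complete
        (cauchySeq_of_le_geometric (3 / 4) (2 * C) (by norm_num) (lem3 z hz.le))
    · rintro z ⟨L, hLt⟩
      refine ⟨B L, ?_⟩
      rw [← tendsto_add_atTop_iff_nat 1]
      exact (hBd.continuous.tendsto L).comp hLt
  choose G hG using hlim
  have hGB : ∀ z, G z = B (G ((2⁻¹ : ℂ) • z)) := by
    intro z
    refine tendsto_nhds_unique ((tendsto_add_atTop_iff_nat 1).2 (hG z)) ?_
    exact (hBd.continuous.tendsto _).comp (hG _)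
  have hGq : ∀ z, ‖z‖ < ρ → ‖G z - z‖ ≤ 2 * C * ‖z‖ ^ q := by
    intro z hz
    exact le_of_tendsto ((hG z).sub_const z).norm (Eventually.of_forall fun n => lem1 n z hz.le)
  have hseqd : ∀ n, Differentiable ℂ (fbSeq B n) := by
    intro n
    induction n with
    | zero => exact differentiable_id
    | succ n ih =>
      exact hBd.comp (ih.comp (differentiable_id.const_smul (2⁻¹ : ℂ)))
  have hGd0 : DifferentiableOn ℂ G (ball 0 ρ) := by
    refine fb_weierstrass isOpen_ball (fun n => (hseqd n).differentiableOn) ?_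
    rw [Metric.tendstoUniformlyOn_iff]
    intro ε hε
    have hev : Tendsto (fun n : ℕ => 2 * C * (3 / 4 : ℝ) ^ n / (1 - 3 / 4)) atTop (𝓝 0) := by
      have := ((tendsto_pow_atTop_nhds_zero_of_lt_one (r := (3 / 4 : ℝ)) (by norm_num)
        (by norm_num)).const_mul (2 * C)).div_const (1 - 3 / 4)
      simpa using this
    filter_upwards [hev.eventually_lt_const hε] with n hn z hz
    rw [dist_comm]
    have hz' : ‖z‖ ≤ ρ := by
      rw [mem_ball_zero_iff] at hz
      exact hz.le
    exact (dist_le_of_le_geometric_of_tendsto (3 / 4) (2 * C) (by norm_num)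
      (lem3 z hz') (hG z) n).trans_lt hn
  refine ⟨G, ?_, ?_, ⟨2 * C, ρ, hρ, hGq⟩, hGB⟩
  · refine fb_exists_induct (P := fun z => DifferentiableAt ℂ G z) hρ ?_ ?_
    · intro z hz
      exact hGd0.differentiableAt (isOpen_ball.mem_nhds (by simpa using hz))
    · intro z hz
      have h1 : G = fun z => B (G ((2⁻¹ : ℂ) • z)) := funext hGB
      rw [h1]
      have h2 : DifferentiableAt ℂ (fun w : E => G ((2⁻¹ : ℂ) • w)) z :=
        DifferentiableAt.comp (g := G) (f := fun w : E => (2⁻¹ : ℂ) • w) z hz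
          (differentiable_id.const_smul (2⁻¹ : ℂ) z)
      exact (hBd _).comp z h2
  · intro x y hxy
    by_contra hne
    have hiter : ∀ n : ℕ, G ((2⁻¹ : ℂ) ^ n • x) = G ((2⁻¹ : ℂ) ^ n • y) := by
      intro n
      induction n with
      | zero => simpa using hxy
      | succ n ih =>
        rw [hGB, hGB ((2⁻¹ : ℂ) ^ n • y)] at ih
        have := hBi ih
        rw [smul_smul, smul_smul] at this
        rw [pow_succ']
        exact this
    have hnn : ∀ (n : ℕ) (z : E), ‖(2⁻¹ : ℂ) ^ n • z‖ = (1 / 2) ^ n * ‖z‖ := by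
      intro n z
      rw [norm_smul, norm_pow, norm_inv, Complex.norm_ofNat]; norm_num
    have hp : Tendsto (fun n : ℕ => (1 / 2 : ℝ) ^ n) atTop (𝓝 0) :=
      tendsto_pow_atTop_nhds_zero_of_lt_one (by norm_num) (by norm_num)
    have hpx : Tendsto (fun n : ℕ => (1 / 2 : ℝ) ^ n * ‖x‖) atTop (𝓝 0) := by
      simpa using hp.mul_const ‖x‖
    have hpy : Tendsto (fun n : ℕ => (1 / 2 : ℝ) ^ n * ‖y‖) atTop (𝓝 0) := by
      simpa using hp.mul_const ‖y‖
    have hpz : Tendsto (fun n : ℕ => (1 / 2 : ℝ) ^ n * (2 * C * (‖x‖ ^ q + ‖y‖ ^ q)))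
        atTop (𝓝 0) := by
      simpa using hp.mul_const (2 * C * (‖x‖ ^ q + ‖y‖ ^ q))
    have hxy0 : 0 < ‖x - y‖ := norm_pos_iff.2 (sub_ne_zero.2 hne)
    obtain ⟨n, h1, h2, h3⟩ := ((hpx.eventually_lt_const hρ).and
      ((hpy.eventually_lt_const hρ).and (hpz.eventually_lt_const hxy0))).exists
    rw [← hnn] at h1 h2
    have e1 := hGq _ h1
    have e2 := hGq _ h2
    rw [← hiter n] at e2
    rw [hnn, mul_pow] at e1 e2
    set a : ℝ := (1 / 2) ^ n with ha
    have ha0 : 0 < a := by positivity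
    have ha1 : a ≤ 1 := pow_le_one₀ (by norm_num) (by norm_num)
    have haq : a ^ q ≤ a ^ 2 := pow_le_pow_of_le_one ha0.le ha1 hq
    have e3 : a * ‖x - y‖ ≤ 2 * C * (a ^ q * ‖x‖ ^ q) + 2 * C * (a ^ q * ‖y‖ ^ q) := by
      rw [ha, ← hnn, smul_sub]
      have : (2⁻¹ : ℂ) ^ n • x - (2⁻¹ : ℂ) ^ n • y =
        (G ((2⁻¹ : ℂ) ^ n • x) - (2⁻¹ : ℂ) ^ n • y) - (G ((2⁻¹ : ℂ) ^ n • x) - (2⁻¹ : ℂ) ^ n • x) := by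
        abel
      rw [this]
      refine (norm_sub_le _ _).trans ?_
      rw [add_comm]
      exact add_le_add e1 e2
    have e4 : a * ‖x - y‖ ≤ a * (a * (2 * C * (‖x‖ ^ q + ‖y‖ ^ q))) := by
      refine e3.trans ?_
      calc _ = a ^ q * (2 * C * (‖x‖ ^ q + ‖y‖ ^ q)) := by ring
        _ ≤ a ^ 2 * (2 * C * (‖x‖ ^ q + ‖y‖ ^ q)) := by gcongr
        _ = _ := by ring
    have e5 := le_of_mul_le_mul_left e4 ha0
    linarith

end PartTwo

section PartThree
variable {V : Type} [NormedAddCommGroup V] [InnerProductSpace ℂ V]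

/-- peak function at `a` -/
noncomputable def fbPeak (a z : V) : ℂ := inner ℂ a (a + z) / (2 * (‖a‖ : ℂ) ^ 2)

theorem fbPeak_diff (a : V) : Differentiable ℂ (fbPeak a) := by
  unfold fbPeak
  have : Differentiable ℂ (fun z : V => inner ℂ a (a + z)) :=
    (innerSL ℂ a).differentiable.comp (differentiable_id.const_add a)
  simp only [div_eq_mul_inv]
  exact this.mul_const _

theorem fbPeak_self {a : V} (ha : a ≠ 0) : fbPeak a a = 1 := by
  unfold fbPeak
  have : (‖a‖ : ℂ) ≠ 0 := by exact_mod_cast norm_ne_zero_iff.2 ha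
  rw [inner_add_right, inner_self_eq_norm_sq_to_K]
  simp only [Complex.coe_algebraMap]
  field_simp
  norm_num

theorem fbPeak_norm_le {a : V} (ha : a ≠ 0) (z : V) : ‖fbPeak a z‖ ≤ ‖a + z‖ / (2 * ‖a‖) := by
  unfold fbPeak
  have h0 : 0 < ‖a‖ := norm_pos_iff.2 ha
  rw [norm_div, norm_mul, norm_pow, Complex.norm_real, Complex.norm_ofNat, norm_norm]
  rw [div_le_div_iff₀ (by positivity) (by positivity)]
  have := norm_inner_le_norm (𝕜 := ℂ) a (a + z)
  calc _ ≤ (‖a‖ * ‖a + z‖) * (2 * ‖a‖) := by gcongr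
    _ = _ := by ring

theorem fbPeak_lt {a z : V} (ha : a ≠ 0) (hz : ‖z‖ ≤ ‖a‖) (hne : z ≠ a) : ‖fbPeak a z‖ < 1 := by
  refine (fbPeak_norm_le ha z).trans_lt ?_
  have h0 : 0 < ‖a‖ := norm_pos_iff.2 ha
  rw [div_lt_one (by positivity)]
  have h1 := parallelogram_law_with_norm ℂ a z
  have h2 : 0 < ‖a - z‖ := norm_pos_iff.2 (sub_ne_zero.2 hne.symm)
  nlinarith [norm_nonneg (a + z), norm_nonneg z]

theorem fb_step (h : V → ℂ) {ρ : ℝ} (g : V → ℝ) (A : Finset V)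
    (hA : ∀ a ∈ A, ρ < ‖a‖ ∧ a ≠ 0) : ∀ ε : ℝ, 0 < ε → ∃ u : V → ℂ, Differentiable ℂ u ∧
      (∀ z, ‖z‖ ≤ ρ → ‖u z‖ ≤ ε) ∧ ∀ a ∈ A, g a < ‖h a + u a‖ := by
  classical
  induction A using Finset.induction_on_max_value (fun x : V => ‖x‖) with
  | empty =>
    intro ε hε
    exact ⟨fun _ => 0, differentiable_const _, fun z _ => by simpa using hε.le, by simp⟩
  | insert a s has hmax ih =>
    intro ε hε
    obtain ⟨u, hud, hu1, hu2⟩ := ih (fun b hb => hA b (Finset.mem_insert_of_mem hb)) (ε / 2)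
      (by positivity)
    obtain ⟨haρ, ha0⟩ := hA a (Finset.mem_insert_self _ _)
    have han : 0 < ‖a‖ := norm_pos_iff.2 ha0
    set c : ℂ := ((|g a| + 1 : ℝ) : ℂ) - (h a + u a) with hc
    set θ : ℝ := (‖a‖ + max ρ 0) / (2 * ‖a‖) with hθ
    have hθ0 : 0 ≤ θ := by positivity
    have hθ1 : θ < 1 := by
      rw [hθ, div_lt_one (by positivity)]
      have : max ρ 0 < ‖a‖ := max_lt haρ han
      linarith
    have ht : ∀ x : ℝ, 0 ≤ x → x < 1 → Tendsto (fun k : ℕ => ‖c‖ * x ^ k) atTop (𝓝 0) := by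
      intro x hx hx1
      simpa using (tendsto_pow_atTop_nhds_zero_of_lt_one hx hx1).const_mul ‖c‖
    have e1 : ∀ᶠ k : ℕ in atTop, ‖c‖ * θ ^ k < ε / 2 :=
      (ht θ hθ0 hθ1).eventually_lt_const (by positivity)
    have e2 : ∀ᶠ k : ℕ in atTop, ∀ x ∈ s, ‖c‖ * ‖fbPeak a x‖ ^ k < ‖h x + u x‖ - g x := by
      rw [Filter.eventually_all_finset]
      intro x hx
      refine (ht _ (norm_nonneg _) (fbPeak_lt ha0 (hmax x hx) ?_)).eventually_lt_const ?_
      · rintro rfl; exact has hx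
      · linarith [hu2 x hx]
    obtain ⟨k, hk1, hk2⟩ := (e1.and e2).exists
    refine ⟨fun z => u z + c * fbPeak a z ^ k, hud.add (((fbPeak_diff a).pow k).const_mul c),
      ?_, ?_⟩
    · intro z hz
      have hp : ‖fbPeak a z‖ ≤ θ := by
        refine (fbPeak_norm_le ha0 z).trans ?_
        rw [hθ]
        gcongr
        exact (norm_add_le _ _).trans (by linarith [le_max_left ρ 0])
      calc _ ≤ ‖u z‖ + ‖c * fbPeak a z ^ k‖ := norm_add_le _ _
        _ = ‖u z‖ + ‖c‖ * ‖fbPeak a z‖ ^ k := by rw [norm_mul, norm_pow]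
        _ ≤ ε / 2 + ‖c‖ * θ ^ k := by gcongr; exact hu1 z hz
        _ ≤ ε := by linarith
    · intro b hb
      rcases Finset.mem_insert.1 hb with rfl | hb
      · beta_reduce
        rw [fbPeak_self ha0]
        have : h b + (u b + c * 1 ^ k) = ((|g b| + 1 : ℝ) : ℂ) := by rw [hc, one_pow]; ring
        rw [this, Complex.norm_real, Real.norm_of_nonneg (by positivity)]
        linarith [le_abs_self (g b)]
      · beta_reduce
        have h1 := hk2 b hb
        rw [← norm_pow, ← norm_mul] at h1
        have h2 : ‖h b + u b‖ ≤ ‖h b + (u b + c * fbPeak a b ^ k)‖ + ‖c * fbPeak a b ^ k‖ := by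
          have := norm_sub_le (h b + (u b + c * fbPeak a b ^ k)) (c * fbPeak a b ^ k)
          rwa [show h b + (u b + c * fbPeak a b ^ k) - c * fbPeak a b ^ k = h b + u b by ring]
            at this
        linarith

theorem fb_entire (T : Set V) (hT : ∀ R : ℝ, (T ∩ closedBall 0 R).Finite) (hT0 : (0 : V) ∉ T)
    (g : V → ℝ) : ∃ f : V → ℂ, Differentiable ℂ f ∧ f 0 = 0 ∧ ∀ t ∈ T, g t < ‖f t‖ := by
  have hstep : ∀ (h : V → ℂ) (N : ℕ), ∃ u : V → ℂ, Differentiable ℂ u ∧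
      (∀ z, ‖z‖ ≤ N → ‖u z‖ ≤ (1 / 2) ^ N) ∧
      ∀ t ∈ T, (N : ℝ) < ‖t‖ → ‖t‖ ≤ N + 1 → g t + 4 < ‖h t + u t‖ := by
    intro h N
    obtain ⟨u, h1, h2, h3⟩ := fb_step h (ρ := N) (fun t => g t + 4)
      ((hT (N + 1)).toFinset.filter (fun t => (N : ℝ) < ‖t‖)) (fun a ha => by
        simp only [Finset.mem_filter, Set.Finite.mem_toFinset] at ha
        refine ⟨ha.2, ?_⟩
        rintro rfl
        exact hT0 ha.1.1) ((1 / 2) ^ N) (by positivity)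
    refine ⟨u, h1, h2, fun t ht hN1 hN2 => h3 t ?_⟩
    simp only [Finset.mem_filter, Set.Finite.mem_toFinset]
    exact ⟨⟨ht, by simpa using hN2⟩, hN1⟩
  choose u hud hu1 hu2 using hstep
  let H : ℕ → V → ℂ := fun n => Nat.rec (fun _ => 0) (fun n h z => h z + u h n z) n
  have hH0 : ∀ z, H 0 z = 0 := fun z => rfl
  have hHs : ∀ n z, H (n + 1) z = H n z + u (H n) n z := fun n z => rfl
  have hHd : ∀ n, Differentiable ℂ (H n) := by
    intro n
    induction n with
    | zero => exact differentiable_const _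
    | succ n ih => exact ih.add (hud _ _)
  have hdist : ∀ (z : V) (n : ℕ), ‖z‖ ≤ n → ∀ k : ℕ,
      dist (H (k + n) z) (H (k + 1 + n) z) ≤ (1 / 2) ^ n * (1 / 2) ^ k := by
    intro z n hn k
    rw [show k + 1 + n = (k + n) + 1 by ring, hHs, dist_eq_norm, sub_add_cancel_left, norm_neg,
      ← pow_add, add_comm n k]
    exact hu1 _ _ z (hn.trans (by push_cast; linarith [Nat.cast_nonneg (α := ℝ) k]))
  have hlim : ∀ z, ∃ L, Tendsto (fun n => H n z) atTop (𝓝 L) := by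
    intro z
    obtain ⟨n, hn⟩ := exists_nat_ge ‖z‖
    obtain ⟨L, hL⟩ := cauchySeq_tendsto_of_complete
      (cauchySeq_of_le_geometric (1 / 2) ((1 / 2) ^ n) (by norm_num) (hdist z n hn))
    exact ⟨L, (tendsto_add_atTop_iff_nat n).1 hL⟩
  choose f hf using hlim
  have hclose : ∀ (z : V) (n : ℕ), ‖z‖ ≤ n → dist (H n z) (f z) ≤ 2 * (1 / 2) ^ n := by
    intro z n hn
    have := dist_le_of_le_geometric_of_tendsto₀ (1 / 2) ((1 / 2) ^ n) (by norm_num)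
      (hdist z n hn) ((tendsto_add_atTop_iff_nat n).2 (hf z))
    rw [zero_add] at this
    refine this.trans (le_of_eq ?_)
    ring
  have hfd : Differentiable ℂ f := by
    intro x
    obtain ⟨M, hM⟩ := exists_nat_gt ‖x‖
    have hT : TendstoUniformlyOn H f atTop (ball 0 M) := by
      rw [Metric.tendstoUniformlyOn_iff]
      intro ε hε
      have hev : Tendsto (fun n : ℕ => 2 * (1 / 2 : ℝ) ^ n) atTop (𝓝 0) := by
        simpa using ((tendsto_pow_atTop_nhds_zero_of_lt_one (r := (1 / 2 : ℝ)) (by norm_num)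
          (by norm_num)).const_mul 2)
      filter_upwards [hev.eventually_lt_const hε, eventually_ge_atTop M] with n hn hnM z hz
      rw [dist_comm]
      rw [mem_ball_zero_iff] at hz
      have : (M : ℝ) ≤ n := by exact_mod_cast hnM
      exact (hclose z n (by linarith)).trans_lt hn
    exact (fb_weierstrass isOpen_ball (fun n => (hHd n).differentiableOn) hT).differentiableAt
      (isOpen_ball.mem_nhds (by simpa using hM))
  have hf0 : ‖f 0‖ ≤ 2 := by
    have := hclose 0 0 (by simp)
    rw [hH0, dist_zero_left] at this
    simpa using this
  refine ⟨fun z => f z - f 0, hfd.sub_const _, sub_self _, fun t ht => ?_⟩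
  have ht0 : 0 < ‖t‖ := norm_pos_iff.2 (by rintro rfl; exact hT0 ht)
  obtain ⟨N, hN1, hN2⟩ : ∃ N : ℕ, (N : ℝ) < ‖t‖ ∧ ‖t‖ ≤ N + 1 := by
    have hc : 0 < ⌈‖t‖⌉₊ := Nat.ceil_pos.2 ht0
    refine ⟨⌈‖t‖⌉₊ - 1, ?_, ?_⟩
    · have := Nat.ceil_lt_add_one ht0.le
      rw [Nat.cast_sub hc]; push_cast; linarith
    · rw [Nat.cast_sub hc]; push_cast
      linarith [Nat.le_ceil ‖t‖]
  have h1 := hu2 (H N) N t ht hN1 hN2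
  rw [← hHs] at h1
  have h2 := hclose t (N + 1) (by push_cast; exact hN2)
  have h3 : 2 * (1 / 2 : ℝ) ^ (N + 1) ≤ 2 := by
    have : (1 / 2 : ℝ) ^ (N + 1) ≤ 1 := pow_le_one₀ (by norm_num) (by norm_num)
    linarith
  rw [dist_eq_norm] at h2
  have h4 : ‖H (N + 1) t‖ ≤ ‖H (N + 1) t - f t‖ + ‖f t - f 0‖ + ‖f 0‖ := by
    have : H (N + 1) t = (H (N + 1) t - f t) + (f t - f 0) + f 0 := by ring
    calc _ = ‖(H (N + 1) t - f t) + (f t - f 0) + f 0‖ := by rw [← this]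
      _ ≤ _ := norm_add₃_le
  linarith

end PartThree

section PartFour

theorem fb_model {V : Type} [NormedAddCommGroup V] [NormedSpace ℂ V] [CompleteSpace V]
    (φ : V →L[ℂ] ℂ) (v : V) (hφ : ∀ x, ‖φ x‖ ≤ ‖x‖) (hv : ‖v‖ ≤ 1) (hφv : φ v = 1)
    {N : ℕ} (hN : 2 ≤ N) :
    ∃ G : V × ℂ → V × ℂ, Differentiable ℂ G ∧ Function.Injective G ∧
      (∃ C, ∃ ρ > 0, ∀ z, ‖z‖ < ρ → ‖G z - z‖ ≤ C * ‖z‖ ^ N) ∧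
      ∀ z, ¬ (4 < ‖(G z).2‖ ∧ ‖(G z).1‖ < ‖(G z).2‖) := by
  let A : V × ℂ → V × ℂ := fun p =>
    ((2⁻¹ : ℂ) • (p.1 + p.2 ^ N • v), (2⁻¹ : ℂ) * (p.2 + (φ (p.1 + p.2 ^ N • v)) ^ N))
  let W : V × ℂ → ℂ := fun p => 2 * p.2 - (φ ((2 : ℂ) • p.1)) ^ N
  let B : V × ℂ → V × ℂ := fun p => ((2 : ℂ) • p.1 - (W p) ^ N • v, W p)
  have hAB : ∀ p, A (B p) = p := by
    intro p
    refine Prod.ext ?_ ?_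
    · simp only [A, B, sub_add_cancel, smul_smul]
      norm_num
    · simp only [A, B, W, sub_add_cancel]
      ring
  have hBs : ContDiff ℂ 1 B := by
    have hW : ContDiff ℂ 1 W := by
      simp only [W]
      fun_prop
    simp only [B]
    fun_prop
  have hBd : Differentiable ℂ B := hBs.differentiable one_ne_zero
  have hBi : Function.Injective B := (show Function.LeftInverse A B from hAB).injective
  set C : ℝ := (2 + 2 ^ N) ^ N with hC
  have hBq : ∀ z, ‖z‖ ≤ 1 → ‖B z - (2 : ℂ) • z‖ ≤ C * ‖z‖ ^ N := by
    intro z hz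
    have h1 : ‖z.1‖ ≤ ‖z‖ := norm_fst_le z
    have h2 : ‖z.2‖ ≤ ‖z‖ := norm_snd_le z
    have h3 : ‖φ ((2 : ℂ) • z.1)‖ ^ N ≤ 2 ^ N * ‖z‖ ^ N := by
      rw [← mul_pow]
      gcongr
      refine (hφ _).trans ?_
      rw [norm_smul, Complex.norm_ofNat]
      linarith
    have h4 : ‖z‖ ^ N ≤ ‖z‖ := by
      simpa using pow_le_pow_of_le_one (norm_nonneg z) hz (show 1 ≤ N by omega)
    have h5 : ‖W z‖ ≤ (2 + 2 ^ N) * ‖z‖ := by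
      calc ‖W z‖ ≤ ‖2 * z.2‖ + ‖(φ ((2 : ℂ) • z.1)) ^ N‖ := norm_sub_le _ _
        _ = 2 * ‖z.2‖ + ‖φ ((2 : ℂ) • z.1)‖ ^ N := by
          rw [norm_mul, norm_pow, Complex.norm_ofNat]
        _ ≤ 2 * ‖z‖ + 2 ^ N * ‖z‖ := by
          have : 2 ^ N * ‖z‖ ^ N ≤ 2 ^ N * ‖z‖ := by gcongr
          linarith
        _ = _ := by ring
    rw [Prod.norm_def]
    refine max_le ?_ ?_
    · simp only [B, Prod.fst_sub, Prod.smul_fst, sub_sub_cancel_left, norm_neg]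
      rw [norm_smul, norm_pow, hC, ← mul_pow]
      calc ‖W z‖ ^ N * ‖v‖ ≤ ‖W z‖ ^ N * 1 := by gcongr
        _ = ‖W z‖ ^ N := mul_one _
        _ ≤ _ := by gcongr
    · simp only [B, W, Prod.snd_sub, Prod.smul_snd, smul_eq_mul, sub_sub_cancel_left, norm_neg]
      rw [norm_pow]
      refine h3.trans ?_
      gcongr
      rw [hC]
      gcongr
      have : (2 : ℝ) ^ 1 ≤ 2 ^ N := pow_le_pow_right₀ (by norm_num) (by omega)
      linarith
  obtain ⟨G, hGd, hGi, hGq, hGB⟩ := fb_limit hBd hBs hBi (C := C) (by positivity) hN hBq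
  refine ⟨G, hGd, hGi, hGq, ?_⟩
  have hAG : ∀ z, A (G z) = G ((2⁻¹ : ℂ) • z) := by
    intro z
    rw [hGB z, hAB]
  have hinv : ∀ p : V × ℂ, (4 < ‖p.2‖ ∧ ‖p.1‖ < ‖p.2‖) → (4 < ‖(A p).2‖ ∧ ‖(A p).1‖ < ‖(A p).2‖) := by
    rintro ⟨z, w⟩ ⟨h1, h2⟩
    simp only at h1 h2
    simp only [A]
    rw [norm_mul, norm_smul, norm_inv, Complex.norm_ofNat]
    set z1 := z + w ^ N • v with hz1
    set x := ‖w‖ with hx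
    have hxN : x ^ 2 ≤ x ^ N := pow_le_pow_right₀ (by linarith) hN
    have e1 : ‖z1‖ ≤ x + x ^ N := by
      calc _ ≤ ‖z‖ + ‖w ^ N • v‖ := norm_add_le _ _
        _ = ‖z‖ + x ^ N * ‖v‖ := by rw [norm_smul, norm_pow]
        _ ≤ x + x ^ N * 1 := by gcongr
        _ = _ := by ring
    have e2 : x ^ N - x ≤ ‖φ z1‖ := by
      have : φ z1 = φ z + w ^ N := by rw [hz1, map_add, map_smul, hφv]; simp
      rw [this]
      have h3 : ‖w ^ N‖ ≤ ‖φ z + w ^ N‖ + ‖φ z‖ := by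
        simpa using norm_sub_le (φ z + w ^ N) (φ z)
      rw [norm_pow] at h3
      linarith [hφ z]
    have e3 : 3 * x ≤ x ^ N - x := by nlinarith
    have e4 : (x ^ N - x) ^ 2 ≤ ‖φ z1‖ ^ N := by
      calc _ ≤ (x ^ N - x) ^ N := pow_le_pow_right₀ (by linarith) hN
        _ ≤ _ := by
          apply pow_le_pow_left₀ (by linarith) e2
    have e5 : ‖φ z1‖ ^ N - x ≤ ‖w + φ z1 ^ N‖ := by
      have h3 : ‖φ z1 ^ N‖ ≤ ‖w + φ z1 ^ N‖ + ‖w‖ := by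
        simpa using norm_sub_le (w + φ z1 ^ N) w
      rw [norm_pow] at h3
      linarith
    have e6 : 2 * x + (x ^ N - x) < (x ^ N - x) ^ 2 - x := by
      nlinarith
    constructor <;> nlinarith
  rintro z hz
  have hall : ∀ n : ℕ, 4 < ‖(G ((2⁻¹ : ℂ) ^ n • z)).2‖ ∧
      ‖(G ((2⁻¹ : ℂ) ^ n • z)).1‖ < ‖(G ((2⁻¹ : ℂ) ^ n • z)).2‖ := by
    intro n
    induction n with
    | zero => simpa using hz
    | succ n ih =>
      have := hinv _ ih
      rw [hAG, smul_smul, ← pow_succ'] at this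
      exact this
  have hG0 : G 0 = 0 := by
    obtain ⟨C', ρ, hρ, h⟩ := hGq
    have := h 0 (by simpa using hρ)
    simpa [show N ≠ 0 by omega] using this
  have ht : Tendsto (fun n : ℕ => G ((2⁻¹ : ℂ) ^ n • z)) atTop (𝓝 0) := by
    have h1 : Tendsto (fun n : ℕ => (2⁻¹ : ℂ) ^ n • z) atTop (𝓝 0) := by
      have := (tendsto_pow_atTop_nhds_zero_of_norm_lt_one (x := (2⁻¹ : ℂ)) (by
        rw [norm_inv, Complex.norm_ofNat]; norm_num)).smul_const z
      simpa using this
    have h2 := (hGd.continuous.tendsto 0).comp h1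
    rwa [hG0] at h2
  have hn := ht.norm
  rw [norm_zero] at hn
  obtain ⟨n, hn⟩ := (hn.eventually_lt_const (show (0 : ℝ) < 4 by norm_num)).exists
  have := norm_snd_le (G ((2⁻¹ : ℂ) ^ n • z))
  linarith [(hall n).1]

theorem fb_conj {E : Type} [NormedAddCommGroup E] [NormedSpace ℂ E] [FiniteDimensional ℂ E]
    {Θ Θi G : E → E} (hΘ : Differentiable ℂ Θ) (hΘi : Differentiable ℂ Θi)
    (hl : Function.LeftInverse Θi Θ) (h0 : Θ 0 = 0) (hG : Differentiable ℂ G) {N : ℕ}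
    (hN : 2 ≤ N)
    (hGq : ∃ C, ∃ ρ > 0, ∀ z, ‖z‖ < ρ → ‖G z - z‖ ≤ C * ‖z‖ ^ N) :
    ∃ C, ∃ ρ > 0, ∀ z, ‖z‖ < ρ → ‖Θi (G (Θ z)) - z‖ ≤ C * ‖z‖ ^ N := by
  obtain ⟨C, ρ, hρ, h⟩ := hGq
  have := FiniteDimensional.complete ℂ E
  have hG0 : G 0 = 0 := by
    have := h 0 (by simpa using hρ)
    simpa [show N ≠ 0 by omega] using this
  have h1 : (fun z => G z - z) =O[𝓝 0] (fun z : E => ‖z‖ ^ N) := by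
    refine Asymptotics.IsBigO.of_bound C ?_
    filter_upwards [ball_mem_nhds (0 : E) hρ] with z hz
    have := h z (by simpa using hz)
    simpa using this
  have hΘt : Tendsto Θ (𝓝 0) (𝓝 0) := by
    have := hΘ.continuous.tendsto 0
    rwa [h0] at this
  have h2 : (fun z => G (Θ z) - Θ z) =O[𝓝 0] (fun z : E => ‖Θ z‖ ^ N) := h1.comp_tendsto hΘt
  have h3 : (fun z => ‖Θ z‖ ^ N) =O[𝓝 0] (fun z : E => ‖z‖ ^ N) := by
    have : Θ =O[𝓝 0] (fun z : E => z) := by simpa [h0] using (hΘ 0).isBigO_sub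
    exact this.norm_norm.pow N
  have hC1 : ContDiff ℂ 1 Θi :=
    contDiff_one_iff_fderiv.2 ⟨hΘi, (fb_fderiv_differentiable hΘi).continuous⟩
  have h4 := (hC1.contDiffAt (x := 0)).hasStrictFDerivAt one_ne_zero |>.isBigO_sub
  have h5 : Tendsto (fun z => (G (Θ z), Θ z)) (𝓝 0) (𝓝 ((0 : E), (0 : E))) := by
    refine Tendsto.prodMk_nhds ?_ hΘt
    have := (hG.continuous.tendsto 0).comp hΘt
    rwa [hG0] at this
  have h6 := ((h4.comp_tendsto h5).trans h2).trans h3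
  obtain ⟨c, hc⟩ := h6.bound
  obtain ⟨δ, hδ, hb⟩ := Metric.eventually_nhds_iff.1 hc
  refine ⟨c, δ, hδ, fun z hz => ?_⟩
  have := hb (y := z) (by simpa using hz)
  simpa [hl z] using this

end PartFour

/-- The zero-dimensional case of **Proposition 1.4**: for a tame closed discrete set
`Σ ⊆ ℂᵈ` (`d ≥ 2`) with `0 ∉ Σ` and each `r ∈ ℕ`, there is an injective holomorphic map
`F : ℂᵈ → ℂᵈ` avoiding `Σ`, with `F(0) = 0` and `F` tangent to the identity at `0` to
order `r`. -/
theorem fatou_bieberbach_avoiding_tame_discrete_set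
    (d : ℕ) (hd : 2 ≤ d) (S : Set (ComplexEuclideanSplit d))
    (hSclosed : IsClosed S) (hSdiscrete : DiscreteTopology S)
    (hStame : IsTame d S) (h0 : (0 : ComplexEuclideanSplit d) ∉ S) (r : ℕ) :
    ∃ F : ComplexEuclideanSplit d → ComplexEuclideanSplit d,
      Differentiable ℂ F ∧
      Injective F ∧
      Disjoint (range F) S ∧
      F 0 = 0 ∧
      ∀ k : ℕ, 1 ≤ k → k ≤ r → iteratedFDeriv ℂ k (fun z => F z - z) 0 = 0 := by
  obtain ⟨Φ, Ψ, hΦ, hΨ, hl, hr, hΓ⟩ := hStame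
  let i0 : Fin (d - 1) := ⟨0, by omega⟩
  let v : EuclideanSpace ℂ (Fin (d - 1)) := EuclideanSpace.single i0 (1 : ℂ)
  let φ : EuclideanSpace ℂ (Fin (d - 1)) →L[ℂ] ℂ := EuclideanSpace.proj i0
  have hφ : ∀ x, ‖φ x‖ ≤ ‖x‖ := fun x => PiLp.norm_apply_le x i0
  have hv : ‖v‖ = 1 := by simp [v]
  have hφv : φ v = 1 := by simp [v, φ]
  obtain ⟨G, hGd, hGi, hGq, hGa⟩ := fb_model φ v hφ hv.le hφv (N := r + 2) (by omega)
  set p := Φ 0 with hp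
  set C : ℝ := 1 + ‖p.1‖ + ‖p.2‖ with hC
  have hS1 : ∀ s ∈ S, ‖(Φ s - p).2‖ ≤ C + ‖(Φ s - p).1‖ := by
    intro s hs
    have h1 : ‖(Φ s).2‖ ≤ 1 + ‖(Φ s).1‖ := hΓ (Set.mem_image_of_mem Φ hs)
    have h2 : ‖(Φ s - p).2‖ ≤ ‖(Φ s).2‖ + ‖p.2‖ := norm_sub_le _ _
    have h3 : ‖(Φ s).1‖ ≤ ‖(Φ s - p).1‖ + ‖p.1‖ := by
      simpa using norm_add_le ((Φ s).1 - p.1) p.1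
    linarith
  have hne : ∀ s ∈ S, Φ s - p ≠ 0 := by
    intro s hs h
    have : Φ s = Φ 0 := sub_eq_zero.1 h
    rw [hl.injective this] at hs
    exact h0 hs
  have hScount : S.Countable := by
    have : Countable S := TopologicalSpace.separableSpace_iff_countable.1 inferInstance
    exact Set.countable_coe_iff.1 this
  have hbad : ((fun s => (-(φ (Φ s - p).1) / (Φ s - p).2).re) '' S).Countable := hScount.image _
  obtain ⟨ε, hεbad, hε0, hε1⟩ := (hbad.dense_compl ℝ).exists_between
    (show (0 : ℝ) < 1 / 2 by norm_num)
  have hεn : ‖(ε : ℂ)‖ ≤ 1 / 2 := by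
    rw [Complex.norm_real, Real.norm_of_nonneg hε0.le]; exact hε1.le
  -- second map
  let T2 : ComplexEuclideanSplit d → ComplexEuclideanSplit d := fun z =>
    ((Φ z - p).1 + ((ε : ℂ) * (Φ z - p).2) • v, (Φ z - p).2)
  let T2i : ComplexEuclideanSplit d → ComplexEuclideanSplit d := fun z =>
    Ψ ((z.1 - ((ε : ℂ) * z.2) • v, z.2) + p)
  have hT2d : Differentiable ℂ T2 := by
    simp only [T2]
    fun_prop
  have hT2id : Differentiable ℂ T2i := by
    simp only [T2i]
    fun_prop
  have hT2l : LeftInverse T2i T2 := by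
    intro z
    simp only [T2, T2i, add_sub_cancel_right, Prod.mk.eta, sub_add_cancel]
    exact hl z
  have hT20 : T2 0 = 0 := by simp [T2, ← hp]
  have hT2w : ∀ s ∈ S, ‖(T2 s).2‖ ≤ 2 * C + 2 * ‖(T2 s).1‖ := by
    intro s hs
    have h1 := hS1 s hs
    have h2 : ‖(Φ s - p).1‖ ≤ ‖(T2 s).1‖ + 1 / 2 * ‖(Φ s - p).2‖ := by
      have e1 : (Φ s - p).1 = (T2 s).1 - ((ε : ℂ) * (Φ s - p).2) • v := by simp [T2]
      have e2 : ‖((ε : ℂ) * (Φ s - p).2) • v‖ ≤ 1 / 2 * ‖(Φ s - p).2‖ := by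
        rw [norm_smul, norm_mul, hv, mul_one]
        gcongr
      calc _ = ‖(T2 s).1 - ((ε : ℂ) * (Φ s - p).2) • v‖ := by rw [← e1]
        _ ≤ ‖(T2 s).1‖ + ‖((ε : ℂ) * (Φ s - p).2) • v‖ := norm_sub_le _ _
        _ ≤ _ := by linarith
    have h3 : (T2 s).2 = (Φ s - p).2 := rfl
    rw [h3]
    linarith
  let T : Set (EuclideanSpace ℂ (Fin (d - 1))) := (fun s => (T2 s).1) '' S
  have hT0 : (0 : EuclideanSpace ℂ (Fin (d - 1))) ∉ T := by
    rintro ⟨s, hs, h⟩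
    have h' : (Φ s - p).1 + ((ε : ℂ) * (Φ s - p).2) • v = 0 := h
    by_cases hw : (Φ s - p).2 = 0
    · rw [hw, mul_zero, zero_smul, add_zero] at h'
      exact hne s hs (Prod.ext h' hw)
    · apply hεbad
      refine ⟨s, hs, ?_⟩
      have h2 := congrArg φ h'
      rw [map_add, map_smul, hφv, map_zero, smul_eq_mul, mul_one] at h2
      have h3 : -(φ (Φ s - p).1) / (Φ s - p).2 = (ε : ℂ) := by
        rw [div_eq_iff hw]
        linear_combination -h2
      simp only [h3, Complex.ofReal_re]
  have hTfin : ∀ R : ℝ, (T ∩ Metric.closedBall 0 R).Finite := by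
    intro R
    have hK : IsCompact (T2i '' (Metric.closedBall (0 : EuclideanSpace ℂ (Fin (d - 1))) R ×ˢ
        Metric.closedBall (0 : ℂ) (2 * C + 2 * R))) :=
      ((isCompact_closedBall _ _).prod (isCompact_closedBall _ _)).image hT2id.continuous
    have hfin := (hK.inter_right hSclosed).finite
      ((isDiscrete_iff_discreteTopology.2 hSdiscrete).mono Set.inter_subset_right)
    refine (hfin.image (fun s => (T2 s).1)).subset ?_
    rintro _ ⟨⟨s, hs, rfl⟩, hsR⟩
    refine ⟨s, ⟨⟨T2 s, ⟨hsR, ?_⟩, hT2l s⟩, hs⟩, rfl⟩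
    have h1 := hT2w s hs
    simp only [mem_closedBall_zero_iff] at hsR ⊢
    linarith
  obtain ⟨f, hfd, hf0, hfT⟩ := fb_entire T hTfin hT0 (fun t => 4 + 2 * C + 3 * ‖t‖)
  let Θ : ComplexEuclideanSplit d → ComplexEuclideanSplit d := fun z =>
    ((T2 z).1, (T2 z).2 + f (T2 z).1)
  let Θi : ComplexEuclideanSplit d → ComplexEuclideanSplit d := fun z =>
    T2i (z.1, z.2 - f z.1)
  have hΘd : Differentiable ℂ Θ := by
    have h1 : Differentiable ℂ (fun z => f (T2 z).1) := hfd.comp hT2d.fst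
    exact hT2d.fst.prodMk (hT2d.snd.add h1)
  have hΘid : Differentiable ℂ Θi := by
    have h1 : Differentiable ℂ (fun z : ComplexEuclideanSplit d => f z.1) :=
      hfd.comp differentiable_fst
    exact hT2id.comp (differentiable_fst.prodMk (differentiable_snd.sub h1))
  have hΘl : LeftInverse Θi Θ := by
    intro z
    simp only [Θ, Θi, add_sub_cancel_right, Prod.mk.eta]
    exact hT2l z
  have hΘr : LeftInverse Θ Θi := by
    intro z
    have h2 : ∀ y, T2 (T2i y) = y := by
      intro y
      simp only [T2, T2i]
      rw [hr]
      simp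
    simp only [Θ, Θi, h2]
    simp
  have hΘ0 : Θ 0 = 0 := by simp [Θ, hT20, hf0]
  have hΘS : ∀ s ∈ S, 4 < ‖(Θ s).2‖ ∧ ‖(Θ s).1‖ < ‖(Θ s).2‖ := by
    intro s hs
    have h1 := hfT (T2 s).1 ⟨s, hs, rfl⟩
    have h2 := hT2w s hs
    have h3 : ‖f (T2 s).1‖ ≤ ‖(Θ s).2‖ + ‖(T2 s).2‖ := by
      simpa [Θ] using norm_sub_le ((T2 s).2 + f (T2 s).1) (T2 s).2
    have h4 : ‖(Θ s).1‖ = ‖(T2 s).1‖ := rfl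
    have h5 := norm_nonneg (T2 s).1
    constructor <;> linarith
  have hbound := fb_conj hΘd hΘid hΘl hΘ0 hGd (by omega) hGq
  have hFd : Differentiable ℂ (fun z => Θi (G (Θ z))) := hΘid.comp (hGd.comp hΘd)
  refine ⟨fun z => Θi (G (Θ z)), hFd, ?_, ?_, ?_, ?_⟩
  · exact hΘr.injective.comp (hGi.comp hΘl.injective)
  · rw [Set.disjoint_left]
    rintro _ ⟨z, rfl⟩ hz
    have := hΘS _ hz
    simp only [hΘr (G (Θ z))] at this
    exact hGa _ this
  · obtain ⟨c, ρ, hρ, h⟩ := hbound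
    have := h 0 (by simpa using hρ)
    simpa using this
  · intro k hk1 hk2
    refine fb_iterated_zero k (hFd.sub differentiable_id) ?_
    obtain ⟨c, ρ, hρ, h⟩ := hbound
    refine ⟨|c|, min ρ 1, lt_min hρ one_pos, fun z hz => ?_⟩
    refine (h z (hz.trans_le (min_le_left _ _))).trans ?_
    have hz1 : ‖z‖ ≤ 1 := (hz.trans_le (min_le_right _ _)).le
    calc c * ‖z‖ ^ (r + 2) ≤ |c| * ‖z‖ ^ (r + 2) := by gcongr; exact le_abs_self c
      _ ≤ |c| * ‖z‖ ^ (k + 1) := by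
        gcongr ?_ * ?_
        exact pow_le_pow_of_le_one (norm_nonneg _) hz1 (by omega)
end

section
/- Let d ≥ 1 and let Σ ⊆ ℂᵈ. Suppose that for each j ∈ {1, …, d} there is a holomorphic function g_j : ℂᵈ → ℂ that does not depend on the j-th coordinate (g_j(z) = g_j(w) whenever zᵢ = wᵢ for all i ≠ j), satisfies g_j(0) = −log 2, and vanishes at every point of Σ. Let Φ_j : ℂᵈ → ℂᵈ replace the j-th coordinate of z by e^{g_j(z)} z_j, leaving the other coordinates unchanged, and set Φ = Φ₁ ∘ Φ₂ ∘ ⋯ ∘ Φ_d. Then Φ is a holomorphic automorphism of ℂᵈ, Φ(σ) = σ for every σ ∈ Σ, Φ(0) = 0, and the derivative of Φ at 0 equals (1/2)·Id. -/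
theorem shear_differentiable {d : ℕ} (j : Fin d) (g : (Fin d → ℂ) → ℂ) (hg : Differentiable ℂ g) :
    Differentiable ℂ (fun z : Fin d → ℂ => Function.update z j (Complex.exp (g z) * z j)) := by
  rw [differentiable_pi]
  intro i
  by_cases h : i = j
  · subst h
    simp only [Function.update_self]
    fun_prop
  · simp only [Function.update_of_ne h]
    fun_prop

theorem shear_inverse {d : ℕ} (j : Fin d) (g h : (Fin d → ℂ) → ℂ)
    (hgh : ∀ z, h z = - g z)
    (hindep : ∀ z w : Fin d → ℂ, (∀ i, i ≠ j → z i = w i) → g z = g w) (z : Fin d → ℂ) :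
    Function.update (Function.update z j (Complex.exp (g z) * z j)) j
      (Complex.exp (h (Function.update z j (Complex.exp (g z) * z j))) *
        (Function.update z j (Complex.exp (g z) * z j)) j) = z := by
  have e : g (Function.update z j (Complex.exp (g z) * z j)) = g z := by
    apply hindep
    intro i hi
    simp [hi]
  rw [hgh, e]
  simp [← mul_assoc, ← Complex.exp_add]

theorem shear_deriv {d : ℕ} (j : Fin d) (g : (Fin d → ℂ) → ℂ) (hg : Differentiable ℂ g)
    (hg0 : g 0 = -((Real.log 2 : ℝ) : ℂ)) :
    ∃ L : (Fin d → ℂ) →L[ℂ] (Fin d → ℂ),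
      HasFDerivAt (fun z : Fin d → ℂ => Function.update z j (Complex.exp (g z) * z j)) L 0 ∧
      ∀ v i, L v i = if i = j then (1 / 2 : ℂ) * v i else v i := by
  have he : Complex.exp (g 0) = 1 / 2 := by
    rw [hg0, ← Complex.ofReal_neg, ← Complex.ofReal_exp, Real.exp_neg, Real.exp_log (by norm_num)]
    norm_num
  refine ⟨ContinuousLinearMap.pi fun i => (if i = j then (1 / 2 : ℂ) else 1) •
    ContinuousLinearMap.proj (R := ℂ) (φ := fun _ : Fin d => ℂ) i, ?_, ?_⟩
  · rw [hasFDerivAt_pi]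
    intro i
    have hp : ∀ i, HasFDerivAt (fun z : Fin d → ℂ => z i)
        (ContinuousLinearMap.proj (R := ℂ) (φ := fun _ : Fin d => ℂ) i) 0 := fun i =>
      hasFDerivAt_apply i 0
    by_cases h : i = j
    · subst h
      simp only [Function.update_self]
      have h2 := ((hg 0).hasFDerivAt.cexp).mul (hp i)
      refine h2.congr_fderiv ?_
      ext v
      simp [he]
    · simp only [Function.update_of_ne h, if_neg h, one_smul]
      exact hp i
  · intro v i
    by_cases h : i = j <;> simp [h]

/-- The key construction in the proof of **Proposition 1.4**. Suppose that for each
`j ∈ {1,…,d}` there is a holomorphic function `g_j : ℂᵈ → ℂ` not depending on the `j`-th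
coordinate, with `g_j(0) = -log 2` and `g_j = 0` on `Σ`. Let `Φ_j` replace the `j`-th
coordinate of `z` by `e^{g_j(z)} z_j`, and let `Φ = Φ₁ ∘ Φ₂ ∘ ⋯ ∘ Φ_d`. Then `Φ` is a
holomorphic automorphism of `ℂᵈ`, `Φ` restricts to the identity on `Σ`, `Φ(0) = 0`, and
`DΦ(0) = ½·Id`. -/
theorem composed_shear_automorphism_attracting_fixed_point
    (d : ℕ) (hd : 1 ≤ d) (S : Set (Fin d → ℂ))
    (g : Fin d → (Fin d → ℂ) → ℂ)
    (hg : ∀ j, Differentiable ℂ (g j))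
    (hindep : ∀ j, ∀ z w : Fin d → ℂ, (∀ i, i ≠ j → z i = w i) → g j z = g j w)
    (hg0 : ∀ j, g j 0 = -((Real.log 2 : ℝ) : ℂ))
    (hgS : ∀ j, ∀ σ ∈ S, g j σ = 0)
    (Φj : Fin d → (Fin d → ℂ) → (Fin d → ℂ))
    (hΦj : ∀ j z, Φj j z = Function.update z j (Complex.exp (g j z) * z j))
    (Φ : (Fin d → ℂ) → (Fin d → ℂ))
    (hΦ : Φ = (List.ofFn Φj).foldr (· ∘ ·) id) :
    Function.Bijective Φ ∧
    Differentiable ℂ Φ ∧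
    (∃ Ψ : (Fin d → ℂ) → (Fin d → ℂ), Differentiable ℂ Ψ ∧
      Function.LeftInverse Ψ Φ ∧ Function.RightInverse Ψ Φ) ∧
    (∀ σ ∈ S, Φ σ = σ) ∧
    Φ 0 = 0 ∧
    (∀ v : Fin d → ℂ, fderiv ℂ Φ 0 v = (1 / 2 : ℂ) • v) := by
  have hdiff : ∀ j, Differentiable ℂ (Φj j) := fun j => by
    have : Φj j = _ := funext (hΦj j)
    rw [this]
    exact shear_differentiable j (g j) (hg j)
  have hinv : ∀ j, ∃ Ψ : (Fin d → ℂ) → (Fin d → ℂ), Differentiable ℂ Ψ ∧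
      Function.LeftInverse Ψ (Φj j) ∧ Function.RightInverse Ψ (Φj j) := fun j => by
    refine ⟨fun z => Function.update z j (Complex.exp (-g j z) * z j),
      shear_differentiable j _ (hg j).neg, ?_, ?_⟩
    · intro z
      rw [hΦj]
      exact shear_inverse j (g j) (fun z => - g j z) (fun _ => rfl) (hindep j) z
    · intro z
      rw [hΦj]
      exact shear_inverse j (fun z => - g j z) (g j) (fun _ => (neg_neg _).symm)
        (fun z w h => congrArg Neg.neg (hindep j z w h)) z
  have hfix : ∀ j, ∀ σ ∈ S, Φj j σ = σ := fun j σ hσ => by simp [hΦj, hgS j σ hσ]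
  have hzero : ∀ j, Φj j 0 = 0 := fun j => by
    rw [hΦj]
    ext i
    by_cases h : i = j <;> simp
  have hder : ∀ j, ∃ L : (Fin d → ℂ) →L[ℂ] (Fin d → ℂ), HasFDerivAt (Φj j) L 0 ∧
      ∀ v i, L v i = if i = j then (1 / 2 : ℂ) * v i else v i := fun j => by
    have : Φj j = _ := funext (hΦj j)
    rw [this]
    exact shear_deriv j (g j) (hg j) (hg0 j)
  have key : ∀ l : List (Fin d), l.Nodup →
      ∀ F : (Fin d → ℂ) → (Fin d → ℂ), F = (l.map Φj).foldr (· ∘ ·) id →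
      Differentiable ℂ F ∧
      (∃ Ψ : (Fin d → ℂ) → (Fin d → ℂ), Differentiable ℂ Ψ ∧
        Function.LeftInverse Ψ F ∧ Function.RightInverse Ψ F) ∧
      (∀ σ ∈ S, F σ = σ) ∧ F 0 = 0 ∧
      ∃ L : (Fin d → ℂ) →L[ℂ] (Fin d → ℂ), HasFDerivAt F L 0 ∧
        ∀ v i, L v i = if i ∈ l then (1 / 2 : ℂ) * v i else v i := by
    intro l
    induction l with
    | nil =>
      rintro - F rfl
      exact ⟨differentiable_id, ⟨id, differentiable_id, fun _ => rfl, fun _ => rfl⟩,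
        fun _ _ => rfl, rfl, ContinuousLinearMap.id ℂ _, hasFDerivAt_id _, by simp⟩
    | cons j l ih =>
      intro hl F hF
      rw [List.nodup_cons] at hl
      obtain ⟨h1, ⟨Ψ, h2, h3, h4⟩, h5, h6, L, h7, h8⟩ := ih hl.2 _ rfl
      rw [List.map_cons, List.foldr_cons] at hF
      generalize (l.map Φj).foldr (· ∘ ·) id = G at *
      subst hF
      obtain ⟨Ψ', k2, k3, k4⟩ := hinv j
      obtain ⟨L', k7, k8⟩ := hder j
      refine ⟨(hdiff j).comp h1, ⟨Ψ ∘ Ψ', h2.comp k2, ?_, ?_⟩, ?_, ?_, L'.comp L, ?_, ?_⟩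
      · intro z
        simp [k3 _, h3 _]
      · intro z
        simp [k4 _, h4 _]
      · intro σ hσ
        simp [h5 σ hσ, hfix j σ hσ]
      · simp [h6, hzero]
      · refine HasFDerivAt.comp 0 ?_ h7
        rw [h6]
        exact k7
      · intro v i
        rw [ContinuousLinearMap.comp_apply, k8, h8]
        by_cases h : i = j
        · subst h
          simp [hl.1]
        · simp [h]
  rw [List.ofFn_eq_map] at hΦ
  obtain ⟨h1, ⟨Ψ, h2, h3, h4⟩, h5, h6, L, h7, h8⟩ := key _ (List.nodup_finRange d) Φ hΦ
  refine ⟨⟨h3.injective, h4.surjective⟩, h1, ⟨Ψ, h2, h3, h4⟩, h5, h6, fun v => ?_⟩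
  rw [h7.fderiv]
  ext i
  simp [h8]
end

section
/- Let a, b ∈ ℂ with a ≠ b. Every holomorphic map g : ℂ → ℂ whose image avoids both a and b (g(z) ≠ a and g(z) ≠ b for all z ∈ ℂ) is constant. -/
open Metric Set Filter Topology in
theorem lp_local (f : ℂ → ℂ) (hf : Differentiable ℂ f) (c : ℂ) (ρ : ℝ) (hρ : 0 < ρ)
    (h0 : deriv f c ≠ 0) (hb : ∀ z ∈ ball c ρ, ‖deriv f z‖ ≤ 2 * ‖deriv f c‖) :
    ball (f c) (ρ * ‖deriv f c‖ / 24) ⊆ range f := by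
  have hd : Differentiable ℂ (deriv f) := by
    have := hf.contDiff (n := 2)
    exact (this.iterate_deriv' 1 1).differentiable (by norm_num)
  set M := ‖deriv f c‖ with hM
  have hMpos : 0 < M := norm_pos_iff.2 h0
  have hmaps : MapsTo (deriv f) (ball c ρ) (closedBall (deriv f c) (3 * M)) := by
    intro z hz
    rw [mem_closedBall, dist_eq_norm]
    calc _ ≤ ‖deriv f z‖ + ‖deriv f c‖ := norm_sub_le _ _
      _ ≤ 3 * M := by linarith [hb z hz]
  have hsch : ∀ z ∈ closedBall c (ρ / 6), ‖deriv f z - deriv f c‖ ≤ M / 2 := by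
    intro z hz
    rw [mem_closedBall] at hz
    have := Complex.dist_le_div_mul_dist_of_mapsTo_ball hd.differentiableOn hmaps
      (z := z) (by rw [mem_ball]; linarith)
    rw [dist_eq_norm] at this
    calc _ ≤ _ := this
      _ ≤ 3 * M / ρ * (ρ / 6) := by gcongr
      _ = M / 2 := by field_simp; norm_num
  have hlow : ∀ z ∈ sphere c (ρ / 6), ρ * M / 12 ≤ ‖f z - f c‖ := by
    intro z hz
    have hz' : ‖z - c‖ = ρ / 6 := by rwa [mem_sphere, dist_eq_norm] at hz
    have key := Convex.norm_image_sub_le_of_norm_hasDerivWithin_le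
      (f := fun w => f w - deriv f c * w) (f' := fun w => deriv f w - deriv f c)
      (s := closedBall c (ρ / 6)) (C := M / 2) (x := c) (y := z)
      (fun w _ => by
        have := ((hf w).hasDerivAt.sub ((hasDerivAt_id w).const_mul (deriv f c))).hasDerivWithinAt
          (s := closedBall c (ρ / 6))
        rw [mul_one] at this
        exact this)
      hsch (convex_closedBall _ _) (mem_closedBall_self (by positivity))
      (sphere_subset_closedBall hz)
    have e : f z - f c = deriv f c * (z - c) +
        ((f z - deriv f c * z) - (f c - deriv f c * c)) := by ring
    have h2 : ‖deriv f c * (z - c)‖ = M * (ρ / 6) := by rw [norm_mul, hz']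
    rw [hz'] at key
    have h3 := norm_sub_le (f z - f c) ((f z - deriv f c * z) - (f c - deriv f c * c))
    have e2 : f z - f c - ((f z - deriv f c * z) - (f c - deriv f c * c)) =
      deriv f c * (z - c) := by ring
    rw [e2, h2] at h3
    nlinarith
  have hfr : ∃ᶠ z in 𝓝 c, f z ≠ f c := by
    have := ((hf c).hasDerivAt.eventually_ne (c := f c) h0).frequently
    exact this.filter_mono nhdsWithin_le_nhds
  have := (hf.diffContOnCl (s := ball c (ρ / 6))).ball_subset_image_closedBall (by positivity)
    hlow hfr
  have e : ρ * M / 12 / 2 = ρ * M / 24 := by ring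
  rw [e] at this
  exact this.trans (image_subset_range _ _)

open Metric Set in
theorem lp_bloch (f : ℂ → ℂ) (hf : Differentiable ℂ f) (c : ℂ) (h0 : deriv f c ≠ 0)
    (R : ℝ) (hR : 0 < R) : ∃ w, ball w (R * ‖deriv f c‖ / 48) ⊆ range f := by
  have hd : Continuous (deriv f) := (hf.contDiff (n := 1)).continuous_deriv le_rfl
  obtain ⟨z, hz, hmax⟩ := (isCompact_closedBall c R).exists_isMaxOn
    ⟨c, mem_closedBall_self hR.le⟩
    (f := fun z => (R - dist z c) * ‖deriv f z‖) (by fun_prop)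
  have hmax' : ∀ w ∈ closedBall c R, (R - dist w c) * ‖deriv f w‖ ≤ (R - dist z c) * ‖deriv f z‖ :=
    fun w hw => hmax hw
  have hc := hmax' c (mem_closedBall_self hR.le)
  rw [dist_self, sub_zero] at hc
  have hpos : 0 < R * ‖deriv f c‖ := mul_pos hR (norm_pos_iff.2 h0)
  rw [mem_closedBall] at hz
  have hzR : 0 < R - dist z c := by
    rcases (sub_nonneg.2 hz).eq_or_lt with h | h
    · rw [← h, zero_mul] at hc; linarith
    · exact h
  have hz0 : deriv f z ≠ 0 := by
    intro h; rw [h, norm_zero, mul_zero] at hc; linarith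
  refine ⟨f z, (ball_subset_ball ?_).trans
    (lp_local f hf z ((R - dist z c) / 2) (by positivity) hz0 ?_)⟩
  · linarith
  · intro w hw
    rw [mem_ball] at hw
    have ht := dist_triangle w z c
    have h1 := hmax' w (by rw [mem_closedBall]; linarith)
    have h2 : (R - dist z c) / 2 * ‖deriv f w‖ ≤ (R - dist w c) * ‖deriv f w‖ := by
      gcongr; linarith
    have h3 : (R - dist z c) * ‖deriv f w‖ ≤ (R - dist z c) * (2 * ‖deriv f z‖) := by linarith
    exact le_of_mul_le_mul_left h3 hzR

theorem lp_log (f : ℂ → ℂ) (hf : Differentiable ℂ f) (h0 : ∀ z, f z ≠ 0) :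
    ∃ L : ℂ → ℂ, Differentiable ℂ L ∧ ∀ z, f z = Complex.exp (L z) := by
  have hd : Differentiable ℂ (deriv f) := by
    have := hf.contDiff (n := 2)
    exact (this.iterate_deriv' 1 1).differentiable (by norm_num)
  have hq : Differentiable ℂ (fun z => deriv f z / f z) := hd.div hf h0
  obtain ⟨L, hL⟩ := hq.isExactOn_univ.with_val_at 0 (Complex.log (f 0))
  obtain ⟨hL0, hL⟩ := hL
  have hL' : ∀ z, HasDerivAt L (deriv f z / f z) z := fun z => by simpa using hL z (Set.mem_univ z)
  refine ⟨L, fun z => (hL' z).differentiableAt, ?_⟩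
  have hder : ∀ z, HasDerivAt (fun z => f z * Complex.exp (-L z)) 0 z := by
    intro z
    have := (hf z).hasDerivAt.mul (hL' z).neg.cexp
    refine HasDerivAt.congr_deriv this ?_
    have e : f z * (deriv f z / f z) = deriv f z := mul_div_cancel₀ _ (h0 z)
    change deriv f z * Complex.exp (-L z) + f z * (Complex.exp (-L z) * -(deriv f z / f z)) = 0
    linear_combination -Complex.exp (-L z) * e
  intro z
  have hc := is_const_of_deriv_eq_zero (fun z => (hder z).differentiableAt)
    (fun z => (hder z).deriv) z 0
  simp only [hL0] at hc
  rw [Complex.exp_neg, Complex.exp_neg, Complex.exp_log (h0 0), mul_inv_cancel₀ (h0 0)] at hc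
  exact (mul_inv_eq_one₀ (Complex.exp_ne_zero _)).1 hc

theorem lp_cos (f : ℂ → ℂ) (hf : Differentiable ℂ f) (h1 : ∀ z, f z ≠ 1) (h2 : ∀ z, f z ≠ -1) :
    ∃ F : ℂ → ℂ, Differentiable ℂ F ∧ ∀ z, f z = Complex.cos (Real.pi * F z) := by
  obtain ⟨L, hL, hLe⟩ := lp_log (fun z => f z ^ 2 - 1) (by fun_prop) (fun z h => by
    have : (f z - 1) * (f z + 1) = 0 := by linear_combination h
    rcases mul_eq_zero.1 this with h | h
    · exact h1 z (by linear_combination h)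
    · exact h2 z (by linear_combination h))
  have hq : ∀ z, f z ^ 2 - 1 = Complex.exp (L z / 2) ^ 2 := fun z => by
    rw [hLe, ← Complex.exp_nat_mul]; congr 1; push_cast; ring
  have hprod : ∀ z, (f z + Complex.exp (L z / 2)) * (f z - Complex.exp (L z / 2)) = 1 :=
    fun z => by linear_combination hq z
  obtain ⟨N, hN, hNe⟩ := lp_log (fun z => f z + Complex.exp (L z / 2)) (by fun_prop)
    (fun z h => by have := hprod z; rw [h, zero_mul] at this; exact zero_ne_one this)
  refine ⟨fun z => N z / (Real.pi * Complex.I), by fun_prop, fun z => ?_⟩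
  have hpi : (Real.pi : ℂ) ≠ 0 := by exact_mod_cast Real.pi_ne_zero
  have e : (Real.pi : ℂ) * (N z / (Real.pi * Complex.I)) * Complex.I = N z := by
    have := Complex.I_ne_zero
    field_simp
  have h3 : Complex.exp (-N z) = f z - Complex.exp (L z / 2) := by
    rw [Complex.exp_neg, ← hNe z]
    exact inv_eq_of_mul_eq_one_right (hprod z)
  rw [Complex.cos, neg_mul, e, h3, ← hNe z]
  ring

theorem lp_cos_add (x : ℂ) (n : ℤ) :
    Complex.cos (x + n * Real.pi) = (-1) ^ n * Complex.cos x := by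
  rw [Complex.cos_antiperiodic.add_int_mul_eq n, n.cast_negOnePow ℂ]

theorem lp_cosh (y : ℝ) : ∃ t : ℝ, |t - y| ≤ 1 ∧ ∃ n : ℤ, Real.cosh (Real.pi * t) = n := by
  have main : ∀ y : ℝ, 0 ≤ y → ∃ t : ℝ, |t - y| ≤ 1 ∧ ∃ n : ℤ, Real.cosh (Real.pi * t) = n := by
    intro y hy
    have hpi := Real.pi_gt_three
    have h1 : Real.cosh (Real.pi * y) + 1 ≤ Real.cosh (Real.pi * (y + 1)) := by
      rw [mul_add, mul_one, Real.cosh_add]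
      have hs : 0 ≤ Real.sinh (Real.pi * y) := Real.sinh_nonneg_iff.2 (by positivity)
      have hs2 : 0 ≤ Real.sinh Real.pi := Real.sinh_nonneg_iff.2 (by positivity)
      have hc := Real.one_le_cosh (Real.pi * y)
      have hc2 : 2 ≤ Real.cosh Real.pi := by
        rw [Real.cosh_eq]
        have := Real.add_one_le_exp Real.pi
        have := Real.exp_pos (-Real.pi)
        linarith
      nlinarith [mul_nonneg hs hs2]
    have hle := Int.le_ceil (Real.cosh (Real.pi * y))
    have hlt := Int.ceil_lt_add_one (Real.cosh (Real.pi * y))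
    obtain ⟨t, ht, hte⟩ := intermediate_value_Icc (a := y) (b := y + 1) (by linarith)
      (f := fun t => Real.cosh (Real.pi * t))
      ((Real.continuous_cosh.comp (continuous_const.mul continuous_id)).continuousOn)
      (show ((⌈Real.cosh (Real.pi * y)⌉ : ℤ) : ℝ) ∈ _ from ⟨hle, by linarith⟩)
    exact ⟨t, by rw [abs_le]; constructor <;> linarith [ht.1, ht.2], _, hte⟩
  rcases le_total 0 y with h | h
  · exact main y h
  · obtain ⟨t, ht, n, hn⟩ := main (-y) (by linarith)
    refine ⟨-t, ?_, n, by rw [mul_neg, Real.cosh_neg, hn]⟩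
    rw [← abs_neg]; convert ht using 2; ring

theorem lp_dense (w : ℂ) : ∃ p : ℂ, ‖p - w‖ < 2 ∧ ∃ n : ℤ, Complex.cos (Real.pi * p) = n := by
  obtain ⟨t, ht, n, hn⟩ := lp_cosh w.im
  refine ⟨(round w.re : ℂ) + t * Complex.I, ?_, (-1) ^ (round w.re).natAbs * n, ?_⟩
  · refine (Complex.norm_le_abs_re_add_abs_im _).trans_lt ?_
    have := abs_sub_round w.re
    rw [abs_sub_comm] at this
    simp
    linarith
  · have e : (Real.pi : ℂ) * ((round w.re : ℂ) + t * Complex.I) =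
      ((Real.pi * t : ℝ) : ℂ) * Complex.I + (round w.re : ℤ) * Real.pi := by push_cast; ring
    rw [e, lp_cos_add, Complex.cos_mul_I, ← Complex.ofReal_cosh, hn]
    push_cast
    congr 1
    rcases Int.even_or_odd (round w.re) with h | h
    · rw [h.neg_one_zpow, (Int.natAbs_even.2 h).neg_one_pow]
    · rw [h.neg_one_zpow, (Int.natAbs_odd.2 h).neg_one_pow]

theorem lp_main (f : ℂ → ℂ) (hf : Differentiable ℂ f) (h1 : ∀ z, f z ≠ 1) (h2 : ∀ z, f z ≠ -1) :
    ∀ z w, f z = f w := by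
  obtain ⟨F, hF, hfF⟩ := lp_cos f hf h1 h2
  have hint : ∀ z (n : ℤ), F z ≠ n := by
    intro z n h
    have hz := hfF z
    have e : (Real.pi : ℂ) * n = 0 + n * Real.pi := by ring
    rw [h, e, lp_cos_add, Complex.cos_zero, mul_one] at hz
    rcases Int.even_or_odd n with hn | hn
    · rw [hn.neg_one_zpow] at hz; exact h1 z hz
    · rw [hn.neg_one_zpow] at hz; exact h2 z hz
  obtain ⟨G, hG, hFG⟩ := lp_cos F hF (fun z => by simpa using hint z 1)
    (fun z => by simpa using hint z (-1))
  have hder : ∀ z, deriv G z = 0 := by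
    intro c
    by_contra h
    have hp : 0 < ‖deriv G c‖ := norm_pos_iff.2 h
    obtain ⟨w, hw⟩ := lp_bloch G hG c h (96 / ‖deriv G c‖) (by positivity)
    have e : 96 / ‖deriv G c‖ * ‖deriv G c‖ / 48 = 2 := by field_simp; norm_num
    rw [e] at hw
    obtain ⟨p, hpw, n, hn⟩ := lp_dense w
    obtain ⟨z, rfl⟩ := hw (show p ∈ Metric.ball w 2 by rwa [Metric.mem_ball, dist_eq_norm])
    exact hint z n (by rw [hFG, hn])
  intro z w
  rw [hfF, hfF, hFG, hFG, is_const_of_deriv_eq_zero hG hder z w]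

/-- The `d = 1` case of Example 2 (little Picard theorem): every holomorphic map
`g : ℂ → ℂ` omitting two distinct values `a, b` is constant. -/
theorem holomorphic_omitting_two_values_constant
    (a b : ℂ) (hab : a ≠ b) (g : ℂ → ℂ) (hg : Differentiable ℂ g)
    (ha : ∀ z, g z ≠ a) (hb : ∀ z, g z ≠ b) :
    ∀ z w : ℂ, g z = g w := by
  have hne : b - a ≠ 0 := sub_ne_zero.2 hab.symm
  have key := lp_main (fun z => (2 * g z - a - b) / (b - a)) (by fun_prop)
    (fun z h => hb z (by
      rw [div_eq_iff hne] at h; linear_combination h / 2))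
    (fun z h => ha z (by
      rw [div_eq_iff hne] at h; linear_combination h / 2))
  intro z w
  have := key z w
  rw [div_left_inj' hne] at this
  linear_combination this / 2
end
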